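/- Let Λ be the limit set of a CIFS on ℝ^d with fixed point set F. Suppose F has covering class f, and let g be the pointwise minimal element of 𝒢(dim_H Λ, d) satisfying f ≤ g pointwise (such a minimal element exists). Then Λ has covering class g. -/

import Mathlib

open Set Metric Filter Topology MeasureTheory

noncomputable section

/-- Least number of open balls of radius `r` needed to cover `E`. -/
def coveringNumber {α : Type*} [PseudoMetricSpace α] (E : Set α) (r : ℝ) : ℕ :=
  sInf {n : ℕ | ∃ t : Finset α, t.card = n ∧ E ⊆ ⋃ x ∈ t, Metric.ball x r}

/-- `s_E(r) = log N_r(E) / log (1/r)`. -/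
def sFun {α : Type*} [PseudoMetricSpace α] (E : Set α) (r : ℝ) : ℝ :=
  Real.log (coveringNumber E r) / Real.log (1 / r)

/-- Lower box dimension. -/
def dimLB {α : Type*} [PseudoMetricSpace α] (E : Set α) : ℝ :=
  Filter.liminf (fun r => sFun E r) (nhdsWithin (0 : ℝ) (Set.Ioi 0))

/-- Upper box dimension. -/
def dimUB {α : Type*} [PseudoMetricSpace α] (E : Set α) : ℝ :=
  Filter.limsup (fun r => sFun E r) (nhdsWithin (0 : ℝ) (Set.Ioi 0))

/-- Upper right Dini derivative. -/
def upperDini (g : ℝ → ℝ) (x : ℝ) : ℝ :=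
  Filter.limsup (fun h => (g (x + h) - g x) / h) (nhdsWithin (0 : ℝ) (Set.Ioi 0))

/-- The class `𝒢(λ, α)`. -/
def GClass (lam alp : ℝ) : Set (ℝ → ℝ) :=
  {g | Continuous g ∧ (∀ x, g x ∈ Set.Icc lam alp) ∧
    ∀ x, upperDini g x ∈ Set.Icc (lam - g x) (alp - g x)}

/-- Asymptotic equivalence of two functions. -/
def AsympEquiv (f g : ℝ → ℝ) : Prop :=
  Filter.Tendsto (fun x => f x - g x) Filter.atTop (nhds 0)

/-- `E` has covering class `g`. -/
def HasCoveringClass {α : Type*} [PseudoMetricSpace α] (E : Set α) (g : ℝ → ℝ) : Prop :=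
  AsympEquiv (fun x => sFun E (Real.exp (-Real.exp x))) g

/-- Composition of the maps indexed by a finite word. -/
def compMaps {α : Type*} {I : Type*} (T : I → α → α) : List I → α → α
  | [] => id
  | i :: w => T i ∘ compMaps T w

/-- A conformal iterated function system on `ℝ^d` satisfying the open set condition
and the cone condition. -/
structure CIFS (d : ℕ) where
  /-- the compact seed set -/
  X : Set (EuclideanSpace ℝ (Fin d))
  /-- the countable index set -/
  I : Type
  /-- the contractions -/
  S : I → EuclideanSpace ℝ (Fin d) → EuclideanSpace ℝ (Fin d)
  hXcompact : IsCompact X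
  hXconn : IsConnected X
  hXint : (interior X).Nonempty
  hIcount : Countable I
  hInonempty : Nonempty I
  hSmaps : ∀ i, Set.MapsTo (S i) X X
  /-- the uniform contraction ratio -/
  c : ℝ
  hc0 : 0 < c
  hc1 : c < 1
  hcontr : ∀ i, ∀ x ∈ X, ∀ y ∈ X,
    (x ≠ y → 0 < dist (S i x) (S i y)) ∧ dist (S i x) (S i y) ≤ c * dist x y
  /-- the open connected set on which the maps extend conformally -/
  V : Set (EuclideanSpace ℝ (Fin d))
  hVopen : IsOpen V
  hVbdd : Bornology.IsBounded V
  hVconn : IsConnected V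
  hXV : X ⊆ V
  /-- the conformal extensions -/
  T : I → EuclideanSpace ℝ (Fin d) → EuclideanSpace ℝ (Fin d)
  hTagree : ∀ i, ∀ x ∈ X, T i x = S i x
  hTmaps : ∀ i, Set.MapsTo (T i) V V
  hTinj : ∀ i, Set.InjOn (T i) V
  /-- the Hölder exponent in `C^{1+ε}` -/
  eps : ℝ
  heps : 0 < eps
  hTdiff : ∀ i, ContDiffOn ℝ 1 (T i) V
  hTholder : ∀ i, ∃ C : ℝ, 0 < C ∧ ∀ x ∈ V, ∀ y ∈ V,
    ‖fderiv ℝ (T i) x - fderiv ℝ (T i) y‖ ≤ C * ‖x - y‖ ^ eps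
  hTconf : ∀ i, ∀ x ∈ V, IsConformalMap (fderiv ℝ (T i) x)
  /-- the bounded distortion constant -/
  K : ℝ
  hK : 1 ≤ K
  hBD : ∀ w : List I, ∀ x ∈ V, ∀ y ∈ V,
    ‖fderiv ℝ (compMaps T w) x‖ ≤ K * ‖fderiv ℝ (compMaps T w) y‖
  hOSCin : ∀ i, S i '' interior X ⊆ interior X
  hOSCdisj : ∀ i j, i ≠ j → Disjoint (S i '' interior X) (S j '' interior X)
  hCone : ∃ κ : ℝ, 0 < κ ∧ ∀ x ∈ X, ∀ r : ℝ, 0 < r → r < 1 →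
    ENNReal.ofReal (κ * r ^ d) ≤ volume (Metric.ball x r ∩ interior X)

/-- The limit set (attractor) of a CIFS. -/
def CIFS.limitSet {d : ℕ} (Φ : CIFS d) : Set (EuclideanSpace ℝ (Fin d)) :=
  ⋃ γ : ℕ → Φ.I, ⋂ n : ℕ, compMaps Φ.S (List.ofFn fun k : Fin (n + 1) => γ k) '' Φ.X

/-- The set of fixed points of the maps of a CIFS. -/
def CIFS.fixedPoints {d : ℕ} (Φ : CIFS d) : Set (EuclideanSpace ℝ (Fin d)) :=
  {x | x ∈ Φ.X ∧ ∃ i, Φ.S i x = x}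

/-- `ρ(w) = sup_{x ∈ X} ‖S'_w(x)‖`. -/
def CIFS.rho {d : ℕ} (Φ : CIFS d) (w : List Φ.I) : ℝ :=
  sSup ((fun x => ‖fderiv ℝ (compMaps Φ.T w) x‖) '' Φ.X)

/-- `Ψ(r, θ) = (1 - θ)·dim_H Λ + θ·s_F(r^θ)`. -/
def CIFS.Psi {d : ℕ} (Φ : CIFS d) (r θ : ℝ) : ℝ :=
  (1 - θ) * (dimH Φ.limitSet).toReal + θ * sFun Φ.fixedPoints (r ^ θ)

/-- `ψ(r) = max_{θ ∈ [0,1]} Ψ(r,θ)` (which equals the supremum over `θ ∈ (0,1]`,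
since `Ψ(r,0)` is defined as the limit of `Ψ(r,θ)` as `θ → 0⁺`). -/
def CIFS.psi {d : ℕ} (Φ : CIFS d) (r : ℝ) : ℝ :=
  sSup (Φ.Psi r '' Set.Ioc (0 : ℝ) 1)

/-- The interval `𝒟(h, s, t, α)`. -/
def Dset (h s t α : ℝ) : Set ℝ :=
  if t ≤ h then {h}
  else Set.Icc (max h s) (h + (t - h) * (α - h) * s / (α * t - h * s))

/-- The quantity whose limit as `θ → 1⁻` is the quasi-Assouad dimension. -/
def quasiAssouadAux {α : Type*} [PseudoMetricSpace α] (E : Set α) (θ : ℝ) : ℝ :=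
  sInf {t : ℝ | 0 ≤ t ∧ ∃ C : ℝ, 0 < C ∧ ∀ x ∈ E, ∀ r R : ℝ,
    0 < r → r ≤ R ^ (1 / θ) → R ^ (1 / θ) ≤ R → R < 1 →
    (coveringNumber (E ∩ Metric.ball x R) r : ℝ) ≤ C * (R / r) ^ t}

/-- The quasi-Assouad dimension. -/
def dimqA {α : Type*} [PseudoMetricSpace α] (E : Set α) : ℝ :=
  Filter.limsup (quasiAssouadAux E) (nhdsWithin (1 : ℝ) (Set.Iio 1))

/-- The modified lower box dimension. -/
def dimLMB {α : Type*} [PseudoMetricSpace α] (K : Set α) : ℝ :=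
  sInf {s : ℝ | ∃ C : ℕ → Set α, (K ⊆ ⋃ i, C i) ∧
    (∀ i, (C i).Nonempty ∧ Bornology.IsBounded (C i)) ∧ s = ⨆ i, dimLB (C i)}

/-- The unit cube `[0,1]^d`. -/
def unitCube (d : ℕ) : Set (EuclideanSpace ℝ (Fin d)) :=
  {x | ∀ j, x j ∈ Set.Icc (0 : ℝ) 1}

/-- The basic similarity maps in the homogeneous Moran construction. -/
def moranMap (d : ℕ) (r : ℝ) (i : Fin d → Bool)
    (x : EuclideanSpace ℝ (Fin d)) : EuclideanSpace ℝ (Fin d) :=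
  (EuclideanSpace.equiv (Fin d) ℝ).symm (fun j => r * x j + (if i j then 1 - r else 0))

/-- The `n`-th level of the homogeneous Moran construction. -/
def moranLevel (d : ℕ) : (ℕ → ℝ) → ℕ → Set (EuclideanSpace ℝ (Fin d))
  | _, 0 => unitCube d
  | r, n + 1 => ⋃ i : Fin d → Bool, moranMap d (r 1) i '' moranLevel d (fun k => r (k + 1)) n

/-- The homogeneous Moran set `M(r)`. -/
def moranSet (d : ℕ) (r : ℕ → ℝ) : Set (EuclideanSpace ℝ (Fin d)) :=
  ⋂ n, moranLevel d r (n + 1)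

/-- The Gauss map `x ↦ 1/x - ⌊1/x⌋`. -/
def gaussMap (x : ℝ) : ℝ := Int.fract (1 / x)

/-- The `n`-th partial quotient (continued fraction digit) of `x` (`n = 0` gives `b₁ = ⌊1/x⌋`). -/
def cfDigit (x : ℝ) (n : ℕ) : ℤ := ⌊1 / gaussMap^[n] x⌋

/-- The set of irrationals in `(0,1)` all of whose continued fraction digits lie in `I`. -/
def cfSet (I : Set ℕ) : Set ℝ :=
  {x | x ∈ Set.Ioo (0 : ℝ) 1 ∧ Irrational x ∧ ∀ n : ℕ, ∃ b ∈ I, cfDigit x n = (b : ℤ)}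


/-- A strictly decreasing function on an open interval cannot have left derivative zero
everywhere. -/
lemma StrictAntiOn.exists_left_slope_ge {φ : ℝ → ℝ} {p q : ℝ} (hpq : p < q)
    (hφ : StrictAntiOn φ (Ioo p q)) :
    ∃ c ∈ Ioo p q, ∃ η > 0, ∀ κ > 0, ∃ c' ∈ Ioo p q,
      c - κ < c' ∧ c' < c ∧ η * (c - c') ≤ φ c' - φ c := by
  by_contra! H
  have jump : ∀ p' q', p ≤ p' → p' < q' → q' ≤ q →
      ∃ c ∈ Ioo p' q', ∃ J > 0, ∀ c₂ ∈ Ioo c q, φ c₂ ≤ φ c - J := by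
    intro p' q' hp hpq' hq
    by_contra! N
    obtain ⟨a, ha, ha'⟩ := exists_between hpq'
    obtain ⟨b, hb, hb'⟩ := exists_between ha'
    have key : ∀ η > 0, φ a - φ b ≤ η * (b - a) := by
      intro η hη
      let T := {c | c ∈ Icc a b ∧ φ c - φ b ≤ η * (b - c)}
      have hbT : b ∈ T := ⟨⟨hb.le, le_rfl⟩, by simp⟩
      have hbdd : BddBelow T := ⟨a, fun x hx => hx.1.1⟩
      have hs1 : a ≤ sInf T := le_csInf ⟨b, hbT⟩ fun x hx => hx.1.1
      have hs2 : sInf T ≤ b := csInf_le hbdd hbT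
      have hsT : sInf T ∈ T := by
        refine ⟨⟨hs1, hs2⟩, ?_⟩
        refine le_of_forall_pos_le_add fun J hJ => ?_
        obtain ⟨c₂, hc₂, h2⟩ := N (sInf T) ⟨by linarith, by linarith⟩ J hJ
        obtain ⟨x, hxT, hx⟩ := exists_lt_of_csInf_lt ⟨b, hbT⟩ hc₂.1
        have hx1 := csInf_le hbdd hxT
        have : φ c₂ ≤ φ x := (hφ ⟨by linarith [hxT.1.1], by linarith [hxT.1.2]⟩
          ⟨by linarith [hc₂.1], hc₂.2⟩ hx).le
        have h3 := hxT.2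
        nlinarith
      rcases hs1.eq_or_lt with h | h
      · have := hsT.2
        rwa [← h] at this
      · exfalso
        obtain ⟨κ, hκ, hk⟩ := H (sInf T) ⟨by linarith, by linarith⟩ η hη
        have h4 : max a (sInf T - κ / 2) < sInf T := max_lt h (by linarith)
        have h5 := le_max_left a (sInf T - κ / 2)
        have h6 := le_max_right a (sInf T - κ / 2)
        have := hk (max a (sInf T - κ / 2)) ⟨by linarith, by linarith⟩ (by linarith) h4
        have h7 : max a (sInf T - κ / 2) ∈ T := by
          refine ⟨⟨h5, by linarith⟩, ?_⟩
          have := hsT.2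
          nlinarith
        exact absurd (csInf_le hbdd h7) (by linarith)
    have h1 : φ b < φ a := hφ ⟨by linarith, by linarith⟩ ⟨by linarith, by linarith⟩ hb
    have h2 := key ((φ a - φ b) / (2 * (b - a))) (by apply div_pos <;> linarith)
    have h3 : (φ a - φ b) / (2 * (b - a)) * (b - a) = (φ a - φ b) / 2 := by
      have : b - a ≠ 0 := by linarith
      field_simp
    linarith
  let m := (p + q) / 2
  have hpm : p < m := by simp only [m]; linarith
  have hmq : m < q := by simp only [m]; linarith
  let P : ℝ × ℝ → Prop := fun z => p < z.1 ∧ z.1 < z.2 ∧ z.2 ≤ m ∧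
    ∀ c₂ ∈ Ioc z.1 z.2, c₂ - z.1 ≤ φ z.1 - φ c₂
  have step : ∀ p' q', p ≤ p' → p' < q' → q' ≤ m → ∃ z, P z ∧ p' < z.1 ∧ z.2 ≤ q' := by
    intro p' q' hp hpq' hq
    obtain ⟨c, hc, J, hJ, h⟩ := jump p' q' hp hpq' (by linarith)
    refine ⟨(c, min q' (c + J)), ⟨by linarith [hc.1], lt_min hc.2 (by linarith),
      (min_le_left _ _).trans hq, ?_⟩, hc.1, min_le_left _ _⟩
    rintro c₂ ⟨h1, h2⟩
    simp only at h1 h2 ⊢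
    have h3 := h2.trans (min_le_left _ _)
    have h4 := h2.trans (min_le_right _ _)
    have := h c₂ ⟨h1, by linarith⟩
    linarith
  obtain ⟨z0, hz0, -, -⟩ := step p m le_rfl hpm le_rfl
  have step' : ∀ z : {z // P z}, ∃ z' : {z // P z}, z.1.1 < z'.1.1 ∧ z'.1.2 ≤ z.1.2 := by
    rintro ⟨z, hz⟩
    obtain ⟨z', h1, h2, h3⟩ := step z.1 z.2 hz.1.le hz.2.1 hz.2.2.1
    exact ⟨⟨z', h1⟩, h2, h3⟩
  choose nxt hn1 hn2 using step'
  let s : ℕ → {z // P z} := fun n => nxt^[n] ⟨z0, hz0⟩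
  have hs : ∀ n, s (n + 1) = nxt (s n) := fun n => Function.iterate_succ_apply' _ _ _
  have hc : StrictMono fun n => (s n).1.1 := strictMono_nat_of_lt_succ fun n => by
    rw [hs]; exact hn1 _
  have he : Antitone fun n => (s n).1.2 := antitone_nat_of_succ_le fun n => by
    rw [hs]; exact hn2 _
  have hce : ∀ i n, (s i).1.1 ≤ (s n).1.2 := by
    intro i n
    have h1 := hc.monotone (le_max_left i n)
    have h2 := he (le_max_right i n)
    have h3 := (s (max i n)).2.2.1
    simp only at h1 h2 h3
    linarith
  have hbdd : BddAbove (range fun n => (s n).1.1) := ⟨(s 0).1.2, by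
    rintro _ ⟨n, rfl⟩; exact hce n 0⟩
  have hlt : ∀ n, (s n).1.1 < ⨆ n, (s n).1.1 := fun n =>
    (hc (Nat.lt_succ_self n)).trans_le (le_ciSup hbdd (n + 1))
  have hle : ∀ n, ⨆ n, (s n).1.1 ≤ (s n).1.2 := fun n => ciSup_le fun i => hce i n
  have hmem : (⨆ n, (s n).1.1) ∈ Ioo p q :=
    ⟨(s 0).2.1.trans (hlt 0), ((hle 0).trans (s 0).2.2.2.1).trans_lt hmq⟩
  obtain ⟨κ, hκ, hk⟩ := H _ hmem 1 one_pos
  obtain ⟨n, hnn⟩ := exists_lt_of_lt_ciSup (show (⨆ n, (s n).1.1) - κ < ⨆ n, (s n).1.1 by linarith)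
  have h1 := hk (s n).1.1 ⟨(s n).2.1, (hlt n).trans hmem.2⟩ hnn (hlt n)
  have h2 := (s n).2.2.2.2 _ ⟨hlt n, hle n⟩
  linarith

/-- If a continuous function is not monotone, then at some point its upper right Dini
derivative is finite and negative. -/
lemma Continuous.exists_dini_neg_of_lt {u : ℝ → ℝ} (hu : Continuous u) {a b : ℝ} (hab : a < b)
    (h : u b < u a) : ∃ x s M : ℝ, 0 < s ∧ (∀ᶠ y in 𝓝[>] x, u y - u x ≤ -s * (y - x)) ∧
      ∃ᶠ y in 𝓝[>] x, -M * (y - x) ≤ u y - u x := by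
  set s := (u a - u b) / (2 * (b - a)) with hs
  have hs0 : 0 < s := by apply div_pos <;> linarith
  have hsv : s * (b - a) = (u a - u b) / 2 := by
    have : b - a ≠ 0 := by linarith
    rw [hs]; field_simp
  set v : ℝ → ℝ := fun x => u x + s * x with hv
  have hvc : Continuous v := by fun_prop
  have hvab : v b < v a := by simp only [hv]; nlinarith
  set Z : ℝ → Set ℝ := fun c => {y | y ∈ Icc a b ∧ c ≤ v y} with hZ
  have hZc : ∀ c, IsCompact (Z c) := fun c =>
    isCompact_Icc.inter_right (isClosed_le continuous_const hvc)
  set φ : ℝ → ℝ := fun c => sSup (Z c) with hφ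
  have hmem : ∀ c ∈ Ioo (v b) (v a), φ c ∈ Z c := fun c hc =>
    (hZc c).sSup_mem ⟨a, ⟨le_rfl, hab.le⟩, hc.2.le⟩
  have hub : ∀ c y, y ∈ Z c → y ≤ φ c := fun c y hy => le_csSup (hZc c).bddAbove hy
  have hval : ∀ c ∈ Ioo (v b) (v a), v (φ c) = c := by
    intro c hc
    obtain ⟨⟨h1, h2⟩, h3⟩ := hmem c hc
    obtain ⟨y, hy, hyc⟩ := intermediate_value_Icc' h2 hvc.continuousOn ⟨hc.1.le, h3⟩
    have := hub c y ⟨⟨h1.trans hy.1, hy.2⟩, hyc.ge⟩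
    rw [← le_antisymm this hy.1, hyc]
  have hanti : StrictAntiOn φ (Ioo (v b) (v a)) := by
    intro c hc c' hc' hcc
    refine lt_of_le_of_ne (hub c _ ⟨(hmem c' hc').1, by rw [hval c' hc']; exact hcc.le⟩) ?_
    intro he
    have := hval c' hc'
    rw [he, hval c hc] at this
    exact hcc.ne this
  obtain ⟨c, hc, η, hη, H⟩ := hanti.exists_left_slope_ge hvab
  have hxb : φ c < b := lt_of_le_of_ne (hmem c hc).1.2 fun he => by
    have := hval c hc
    rw [he] at this
    exact hc.1.ne this
  have hlt : ∀ y, φ c < y → y ≤ b → v y < c := by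
    intro y hy hyb
    by_contra! hcy
    exact absurd (hub c y ⟨⟨(hmem c hc).1.1.trans hy.le, hyb⟩, hcy⟩) (not_le.2 hy)
  refine ⟨φ c, s, 1 / η + s, hs0, ?_, ?_⟩
  · filter_upwards [Ioo_mem_nhdsGT hxb] with y hy
    have h1 := hlt y hy.1 hy.2.le
    rw [← hval c hc] at h1
    simp only [hv] at h1
    linarith
  · rw [(nhdsGT_basis (φ c)).frequently_iff]
    intro w hw
    set w' := min w b with hw'
    have hw1 : φ c < w' := lt_min hw hxb
    obtain ⟨m, hm, hmax⟩ := (isCompact_Icc (a := w') (b := b)).exists_isMaxOn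
      ⟨b, min_le_right _ _, le_rfl⟩ hvc.continuousOn
    have hmc : v m < c := hlt m (hw1.trans_le hm.1) hm.2
    obtain ⟨c', hc', h1, h2, h3⟩ := H (c - v m) (by linarith)
    have hyx : φ c < φ c' := hanti hc' hc h2
    have hyw : φ c' < w' := by
      by_contra! hge
      have h4 : v (φ c') ≤ v m := hmax ⟨hge, (hmem c' hc').1.2⟩
      rw [hval c' hc'] at h4
      linarith
    refine ⟨φ c', ⟨hyx, hyw.trans_le (min_le_left _ _)⟩, ?_⟩
    have h5 : c - c' ≤ 1 / η * (φ c' - φ c) := by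
      rw [one_div, inv_mul_eq_div, le_div_iff₀ hη]; linarith
    have h6 := hval c hc
    have h7 := hval c' hc'
    simp only [hv] at h6 h7
    nlinarith

lemma map_add_nhdsGT_zero (x : ℝ) : map (fun h => x + h) (𝓝[>] (0 : ℝ)) = 𝓝[>] x := by
  simp

/-- Functions in `𝒢(λ, α)` decay at most exponentially fast towards `λ`. -/
lemma GClass.monotone_mul_exp {lam alp : ℝ} {g : ℝ → ℝ} (hg : g ∈ GClass lam alp) :
    Monotone fun x => (g x - lam) * Real.exp x := by
  obtain ⟨hc, hI, hD⟩ := hg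
  by_contra hmono
  simp only [Monotone, not_forall, not_le] at hmono
  obtain ⟨a, b, hab, hlt⟩ := hmono
  have hab' : a < b := lt_of_le_of_ne hab fun h => by rw [h] at hlt; exact lt_irrefl _ hlt
  obtain ⟨x, s, M, hs, h1, h2⟩ := Continuous.exists_dini_neg_of_lt
    (u := fun x => (g x - lam) * Real.exp x) (by fun_prop) hab' hlt
  rw [← map_add_nhdsGT_zero] at h1 h2
  rw [eventually_map] at h1
  rw [frequently_map] at h2
  simp only [add_sub_cancel_left] at h1 h2
  have hex := Real.exp_pos x
  -- the difference quotient in terms of that of `(g - λ) exp`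
  have e1 : ∀ h, g (x + h) - g x = Real.exp (-(x + h)) *
      ((g (x + h) - lam) * Real.exp (x + h) - (g x - lam) * Real.exp x)
      + (g x - lam) * (Real.exp (-h) - 1) := by
    intro h
    have h1 : Real.exp (-(x + h)) * Real.exp (x + h) = 1 := by rw [← Real.exp_add]; simp
    have h2 : Real.exp (-(x + h)) * Real.exp x = Real.exp (-h) := by
      rw [← Real.exp_add]; ring_nf
    linear_combination (-(g (x + h) - lam)) * h1 + (g x - lam) * h2
  have hgx : 0 ≤ g x - lam := by linarith [(hI x).1]
  have hlin : Tendsto (fun h : ℝ => (Real.exp (-h) - 1) / h) (𝓝[>] 0) (𝓝 (-1)) := by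
    have : HasDerivAt (fun h : ℝ => Real.exp (-h)) (-1) 0 := by
      have := (hasDerivAt_neg (0 : ℝ)).exp
      simpa using this
    have := (hasDerivAt_iff_tendsto_slope.1 this).mono_left
      (nhdsWithin_mono 0 (fun y (hy : 0 < y) => hy.ne'))
    refine this.congr fun h => ?_
    simp [slope_def_field]
  have hexp : Tendsto (fun h : ℝ => Real.exp (-(x + h))) (𝓝[>] 0) (𝓝 (Real.exp (-x))) := by
    have : Continuous fun h : ℝ => Real.exp (-(x + h)) := by fun_prop
    have := this.tendsto 0
    simp only [add_zero] at this
    exact this.mono_left nhdsWithin_le_nhds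
  set ub : ℝ → ℝ := fun h => Real.exp (-(x + h)) * (-s) + (g x - lam) * ((Real.exp (-h) - 1) / h)
  have hub : Tendsto ub (𝓝[>] 0) (𝓝 (Real.exp (-x) * (-s) + (g x - lam) * (-1))) :=
    (hexp.mul_const _).add (hlin.const_mul _)
  have hle : ∀ᶠ h in 𝓝[>] (0 : ℝ), (g (x + h) - g x) / h ≤ ub h := by
    filter_upwards [h1, self_mem_nhdsWithin] with h hh (hpos : 0 < h)
    rw [e1 h, add_div, mul_div_assoc, mul_div_assoc]
    refine add_le_add_left (mul_le_mul_of_nonneg_left ?_ (Real.exp_pos _).le) _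
    rw [div_le_iff₀ hpos]
    exact hh
  have hge : ∃ᶠ h in 𝓝[>] (0 : ℝ),
      Real.exp (-x) * (-|M|) + (g x - lam) * (-1) - 1 ≤ (g (x + h) - g x) / h := by
    have hlow : Tendsto (fun h => Real.exp (-(x + h)) * (-|M|) +
        (g x - lam) * ((Real.exp (-h) - 1) / h)) (𝓝[>] 0)
        (𝓝 (Real.exp (-x) * (-|M|) + (g x - lam) * (-1))) :=
      (hexp.mul_const _).add (hlin.const_mul _)
    refine (h2.and_eventually (Filter.Eventually.and
      (p := fun h : ℝ => 0 < h) self_mem_nhdsWithin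
      (hlow.eventually (lt_mem_nhds (sub_one_lt _))))).mono ?_
    rintro h ⟨hh, (hpos : 0 < h), h3⟩
    refine h3.le.trans ?_
    rw [e1 h, add_div, mul_div_assoc, mul_div_assoc]
    refine add_le_add_left (mul_le_mul_of_nonneg_left ?_ (Real.exp_pos _).le) _
    rw [le_div_iff₀ hpos]
    have : -|M| * h ≤ -M * h := by
      apply mul_le_mul_of_nonneg_right _ hpos.le
      linarith [le_abs_self M]
    linarith
  have hlt' : Real.exp (-x) * (-s) + (g x - lam) * (-1) < lam - g x := by
    have := mul_pos (Real.exp_pos (-x)) hs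
    linarith
  obtain ⟨t, ht1, ht2⟩ := exists_between hlt'
  have hle' : ∀ᶠ h in 𝓝[>] (0 : ℝ), (g (x + h) - g x) / h ≤ t := by
    filter_upwards [hle, hub.eventually (gt_mem_nhds ht1)] with h h1 h2
    exact h1.trans h2.le
  have hlim : upperDini g x ≤ t := limsup_le_of_le (IsCoboundedUnder.of_frequently_ge hge) hle'
  linarith [(hD x).1]

/-- The function in `𝒢(h, α)` which follows `f` upwards and decays towards `h` at the maximal
rate otherwise. -/
lemma GClass.exists_envelope {f : ℝ → ℝ} {h α : ℝ} (hα : h ≤ α)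
    (hf : f ∈ GClass 0 α) : ∃ G ∈ GClass h α, (∀ x, f x ≤ G x) ∧
      ∀ x b, (∀ y ≤ x, h + (f y - h) * Real.exp (y - x) ≤ b) → G x ≤ b := by
  obtain ⟨hc, hI, hD⟩ := hf
  set q : ℝ → ℝ := fun y => (f y - h) * Real.exp y with hq
  have hqc : Continuous q := by fun_prop
  have hqle : ∀ x y, y ≤ x → q y ≤ (α - h) * Real.exp x := by
    intro x y hyx
    have h1 : Real.exp y ≤ Real.exp x := Real.exp_le_exp.2 hyx
    have h2 : f y - h ≤ α - h := by linarith [(hI y).2]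
    calc q y ≤ (α - h) * Real.exp y := mul_le_mul_of_nonneg_right h2 (Real.exp_pos _).le
      _ ≤ _ := mul_le_mul_of_nonneg_left h1 (by linarith)
  set M : ℝ → ℝ := fun x => sSup (q '' Iic x) with hM
  have hbdd : ∀ x, BddAbove (q '' Iic x) := fun x =>
    ⟨(α - h) * Real.exp x, by rintro _ ⟨y, hy, rfl⟩; exact hqle x y hy⟩
  have hqM : ∀ x y, y ≤ x → q y ≤ M x := fun x y hy => le_csSup (hbdd x) ⟨y, hy, rfl⟩
  have hMle : ∀ x b, (∀ y ≤ x, q y ≤ b) → M x ≤ b := fun x b hb =>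
    csSup_le ⟨q x, x, self_mem_Iic, rfl⟩ (by rintro _ ⟨y, hy, rfl⟩; exact hb y hy)
  have hmono : Monotone M := fun x y hxy => hMle x _ fun z hz => hqM y z (hz.trans hxy)
  have hM0 : ∀ x, 0 ≤ M x := by
    intro x
    have h1 : Tendsto (fun y => -h * Real.exp y) atBot (𝓝 (-h * 0)) :=
      Real.tendsto_exp_atBot.const_mul _
    rw [mul_zero] at h1
    refine le_of_tendsto h1 ?_
    filter_upwards [eventually_le_atBot x] with y hy
    refine le_trans ?_ (hqM x y hy)
    exact mul_le_mul_of_nonneg_right (by linarith [(hI y).1]) (Real.exp_pos _).le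
  have hdich : ∀ x y, x ≤ y → M y ≤ M x ∨ ∃ z ∈ Icc x y, M y ≤ q z := by
    intro x y hxy
    obtain ⟨z, hz, hmax⟩ := (isCompact_Icc (a := x) (b := y)).exists_isMaxOn ⟨x, le_rfl, hxy⟩
      hqc.continuousOn
    rcases le_total (M x) (q z) with hle | hle
    · refine Or.inr ⟨z, hz, hMle _ _ fun w hw => ?_⟩
      rcases le_total w x with h1 | h1
      · exact (hqM x w h1).trans hle
      · exact hmax ⟨h1, hw⟩
    · refine Or.inl (hMle _ _ fun w hw => ?_)
      rcases le_total w x with h1 | h1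
      · exact hqM x w h1
      · exact (show q w ≤ q z from hmax ⟨h1, hw⟩).trans hle
  have hMc : Continuous M := by
    rw [Metric.continuous_iff]
    intro x ε hε
    obtain ⟨δ, hδ, hd⟩ := Metric.continuous_iff.1 hqc x (ε / 2) (by linarith)
    refine ⟨δ, hδ, fun y hy => ?_⟩
    rw [Real.dist_eq, abs_lt] at hy
    have near : ∀ z, |z - x| < δ → |q z - q x| < ε / 2 := fun z hz => hd z hz
    rw [Real.dist_eq]
    rcases le_total x y with hxy | hxy
    · have h1 := hmono hxy
      rw [abs_of_nonneg (by linarith)]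
      rcases hdich x y hxy with h2 | ⟨z, hz, h2⟩
      · linarith
      · have := abs_lt.1 (near z (by rw [abs_lt]; constructor <;> linarith [hz.1, hz.2]))
        linarith [hqM x x le_rfl]
    · have h1 := hmono hxy
      rw [abs_sub_comm, abs_of_nonneg (by linarith)]
      rcases hdich y x hxy with h2 | ⟨z, hz, h2⟩
      · linarith
      · have h3 := abs_lt.1 (near z (by rw [abs_lt]; constructor <;> linarith [hz.1, hz.2]))
        have h4 := abs_lt.1 (near y (by rw [abs_lt]; constructor <;> linarith))
        linarith [hqM y y le_rfl]
  set G : ℝ → ℝ := fun x => h + M x * Real.exp (-x) with hG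
  have hinv : ∀ x, Real.exp x * Real.exp (-x) = 1 := fun x => by rw [← Real.exp_add]; simp
  have hGα : ∀ x, G x ≤ α := by
    intro x
    have h1 : M x * Real.exp (-x) ≤ (α - h) * Real.exp x * Real.exp (-x) :=
      mul_le_mul_of_nonneg_right (hMle x _ (hqle x)) (Real.exp_pos _).le
    rw [mul_assoc, hinv] at h1
    simp only [hG]; linarith
  have hGh : ∀ x, h ≤ G x := fun x => by
    have := mul_nonneg (hM0 x) (Real.exp_pos (-x)).le
    simp only [hG]; linarith
  have hqG : ∀ x, q x * Real.exp (-x) = f x - h := fun x => by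
    simp only [hq]; rw [mul_assoc, hinv, mul_one]
  have hfG : ∀ x, f x ≤ G x := by
    intro x
    have := mul_le_mul_of_nonneg_right (hqM x x le_rfl) (Real.exp_pos (-x)).le
    rw [hqG] at this
    simp only [hG]; linarith
  refine ⟨G, ⟨by fun_prop, fun x => ⟨hGh x, hGα x⟩, fun x => ?_⟩, hfG, ?_⟩
  · -- the Dini derivative condition
    set Q : ℝ → ℝ := fun ε => (G (x + ε) - G x) / ε with hQ
    have hlow : ∀ ε > 0, h - G x ≤ Q ε := by
      intro ε hε
      rw [hQ, le_div_iff₀ hε]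
      have h1 : M x * Real.exp (-(x + ε)) ≤ M (x + ε) * Real.exp (-(x + ε)) :=
        mul_le_mul_of_nonneg_right (hmono (by linarith)) (Real.exp_pos _).le
      have h2 : Real.exp (-(x + ε)) = Real.exp (-x) * Real.exp (-ε) := by
        rw [← Real.exp_add]; ring_nf
      have h3 : 1 - ε ≤ Real.exp (-ε) := by linarith [Real.add_one_le_exp (-ε)]
      have h4 := mul_le_mul_of_nonneg_left h3 (mul_nonneg (hM0 x) (Real.exp_pos (-x)).le)
      rw [h2] at h1
      simp only [hG, h2]
      nlinarith
    have hfreq : ∃ᶠ ε in 𝓝[>] (0 : ℝ), h - G x ≤ Q ε := by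
      refine Eventually.frequently ?_
      filter_upwards [self_mem_nhdsWithin] with ε hε using hlow ε hε
    by_cases hb : IsBoundedUnder (· ≤ ·) (𝓝[>] (0 : ℝ)) Q
    swap
    · have : upperDini G x = 0 := by
        have hempty : {a : ℝ | ∀ᶠ ε in 𝓝[>] (0 : ℝ), Q ε ≤ a} = ∅ := by
          rw [eq_empty_iff_forall_notMem]
          exact fun a ha => hb ⟨a, ha⟩
        rw [upperDini, limsup_eq, hempty, Real.sInf_empty]
      rw [this]
      exact ⟨by linarith [hGh x], by linarith [hGα x]⟩
    refine ⟨le_limsup_of_frequently_le hfreq hb, ?_⟩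
    refine le_of_forall_gt_imp_ge_of_dense fun a ha => ?_
    have ha0 : 0 ≤ a := by linarith [hGα x]
    refine limsup_le_of_le (IsCoboundedUnder.of_frequently_ge hfreq) ?_
    rcases (hqM x x le_rfl).eq_or_lt with heq | hlt
    · have hGf : G x = f x := by simp only [hG]; rw [← heq, hqG]; ring
      have hfb : IsBoundedUnder (· ≤ ·) (𝓝[>] (0 : ℝ)) fun ε => (f (x + ε) - f x) / ε := by
        obtain ⟨B, hB⟩ := hb
        refine ⟨B, ?_⟩
        rw [eventually_map] at hB ⊢
        filter_upwards [hB, self_mem_nhdsWithin] with ε h1 (hε : 0 < ε)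
        refine le_trans ?_ h1
        simp only [hQ]
        rw [hGf]
        gcongr
        exact hfG _
      have hfa := eventually_lt_of_limsup_lt
        (lt_of_le_of_lt (hD x).2 (show α - f x < a by rw [← hGf]; exact ha)) hfb
      obtain ⟨δ, hδ, hδa⟩ := (nhdsGT_basis (0 : ℝ)).eventually_iff.1 hfa
      have hfz : ∀ z, x ≤ z → z < x + δ → f z ≤ f x + a * (z - x) := by
        intro z hz hzδ
        rcases hz.eq_or_lt with rfl | hz
        · simp
        · have := hδa ⟨sub_pos.2 hz, by linarith⟩
          rw [div_lt_iff₀ (sub_pos.2 hz), add_sub_cancel] at this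
          linarith
      have hfx : 0 ≤ f x - h := by rw [← hGf]; linarith [hGh x]
      filter_upwards [Ioo_mem_nhdsGT hδ] with ε hε
      rw [div_le_iff₀ hε.1, hGf]
      have hM' : ∃ z ∈ Icc x (x + ε), M (x + ε) ≤ q z := by
        rcases hdich x (x + ε) (by linarith [hε.1]) with h1 | h1
        · exact ⟨x, ⟨le_rfl, by linarith [hε.1]⟩, by rw [heq]; exact h1⟩
        · exact h1
      obtain ⟨z, hz, hMz⟩ := hM'
      have h1 := hfz z hz.1 (by linarith [hz.2, hε.2])
      have h2 : M (x + ε) * Real.exp (-(x + ε)) ≤ (f z - h) * Real.exp (z - (x + ε)) := by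
        have : (f z - h) * Real.exp (z - (x + ε)) = q z * Real.exp (-(x + ε)) := by
          simp only [hq]; rw [mul_assoc, ← Real.exp_add]; ring_nf
        rw [this]
        exact mul_le_mul_of_nonneg_right hMz (Real.exp_pos _).le
      have h3 : Real.exp (z - (x + ε)) ≤ 1 := Real.exp_le_one_iff.2 (by linarith [hz.2])
      have h4 : (f z - h) * Real.exp (z - (x + ε)) ≤
          (f x - h + a * (z - x)) * Real.exp (z - (x + ε)) :=
        mul_le_mul_of_nonneg_right (by linarith) (Real.exp_pos _).le
      have h5 : (f x - h + a * (z - x)) * Real.exp (z - (x + ε)) ≤ f x - h + a * (z - x) :=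
        mul_le_of_le_one_right
          (add_nonneg hfx (mul_nonneg ha0 (by linarith [hz.1]))) h3
      have h6 : a * (z - x) ≤ a * ε := mul_le_mul_of_nonneg_left (by linarith [hz.2]) ha0
      simp only [hG]
      linarith
    · have hev : ∀ᶠ z in 𝓝 x, q z < M x := hqc.continuousAt.eventually (gt_mem_nhds hlt)
      obtain ⟨δ, hδ, hδa⟩ := Metric.eventually_nhds_iff.1 hev
      filter_upwards [Ioo_mem_nhdsGT hδ] with ε hε
      have h1 : M (x + ε) ≤ M x := by
        rcases hdich x (x + ε) (by linarith [hε.1]) with h1 | ⟨z, hz, h1⟩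
        · exact h1
        · have : dist z x < δ := by
            rw [Real.dist_eq, abs_lt]; constructor <;> linarith [hz.1, hz.2, hε.1, hε.2]
          linarith [hδa this]
      rw [div_le_iff₀ hε.1]
      have h2 : Real.exp (-(x + ε)) ≤ Real.exp (-x) := Real.exp_le_exp.2 (by linarith [hε.1])
      have h3 := mul_le_mul h1 h2 (Real.exp_pos _).le (hM0 x)
      have h4 := mul_nonneg ha0 hε.1.le
      simp only [hG]
      linarith
  · intro x b hb
    have h1 : M x ≤ (b - h) * Real.exp x := by
      refine hMle x _ fun y hy => ?_
      have h2 := hb y hy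
      have h3 : q y = (f y - h) * Real.exp (y - x) * Real.exp x := by
        simp only [hq]; rw [mul_assoc, ← Real.exp_add]; ring_nf
      rw [h3]
      exact mul_le_mul_of_nonneg_right (by linarith) (Real.exp_pos _).le
    have h2 := mul_le_mul_of_nonneg_right h1 (Real.exp_pos (-x)).le
    rw [mul_assoc, hinv] at h2
    simp only [hG]; linarith

/-- An iterated function system satisfying the open set condition, all of whose compositions
`S_w` are, up to uniform constants, similarities with ratio `ρ w`. -/
structure IsQuasiSimilarIFS {d : ℕ} {I : Type} (X : Set (EuclideanSpace ℝ (Fin d)))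
    (S : I → EuclideanSpace ℝ (Fin d) → EuclideanSpace ℝ (Fin d))
    (ρ : List I → ℝ) (K A c : ℝ) : Prop where
  isCompact : IsCompact X
  nonempty_interior : (interior X).Nonempty
  mapsTo : ∀ i, MapsTo (S i) X X
  image_interior : ∀ i, S i '' interior X ⊆ interior X
  disjoint : ∀ i j, i ≠ j → Disjoint (S i '' interior X) (S j '' interior X)
  one_le_K : 1 ≤ K
  one_le_A : 1 ≤ A
  c_pos : 0 < c
  c_lt_one : c < 1
  ratio_nil : ρ [] = 1
  ratio_pos : ∀ w, 0 < ρ w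
  ratio_le : ∀ w, ρ w ≤ c ^ w.length
  ratio_append : ∀ w v, ρ w * ρ v ≤ K * ρ (w ++ v)
  dist_le : ∀ w, ∀ x ∈ X, ∀ y ∈ X,
    dist (compMaps S w x) (compMaps S w y) ≤ A * ρ w * dist x y
  le_dist : ∀ w, ∀ x ∈ X, ∀ y ∈ X,
    ρ w * dist x y ≤ A * dist (compMaps S w x) (compMaps S w y)

/-- The limit set of the maps `S` with seed set `X`. -/
def limitSetOf {α I : Type*} (X : Set α) (S : I → α → α) : Set α :=
  ⋃ γ : ℕ → I, ⋂ n : ℕ, compMaps S (List.ofFn fun k : Fin (n + 1) => γ k) '' X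

lemma compMaps_append {α I : Type*} (T : I → α → α) (w v : List I) :
    compMaps T (w ++ v) = compMaps T w ∘ compMaps T v := by
  induction w with
  | nil => rfl
  | cons i w ih => simp only [List.cons_append, compMaps, ih]; rfl

lemma compMaps_flatten {α I : Type*} (T : I → α → α) {W : Set (List I)} (l : List W) :
    compMaps (fun w : W => compMaps T w) l = compMaps T (l.map Subtype.val).flatten := by
  induction l with
  | nil => rfl
  | cons i w ih => simp only [List.map_cons, List.flatten_cons, compMaps_append, compMaps, ih]

lemma compMaps_mapsTo {α I : Type*} {T : I → α → α} {X : Set α} (h : ∀ i, MapsTo (T i) X X)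
    (w : List I) : MapsTo (compMaps T w) X X := by
  induction w with
  | nil => exact mapsTo_id X
  | cons i w ih => exact (h i).comp ih

lemma mem_limitSetOf_of_subset {α I : Type*} {X A : Set α} {S : I → α → α} (hAX : A ⊆ X)
    (hA : A ⊆ ⋃ i, S i '' A) : A ⊆ limitSetOf X S := by
  have h : ∀ a : A, ∃ (i : I) (b : A), S i b = a := by
    rintro ⟨a, ha⟩
    obtain ⟨i, b, hb, hba⟩ := mem_iUnion.1 (hA ha)
    exact ⟨i, ⟨b, hb⟩, hba⟩
  choose i b hib using h
  have key : ∀ (n : ℕ) (a : A),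
      compMaps S (List.ofFn fun k : Fin n => i (b^[k] a)) (b^[n] a) = a := by
    intro n
    induction n with
    | zero => intro a; rfl
    | succ n ih =>
      intro a
      rw [List.ofFn_succ]
      have := ih (b a)
      simp only [compMaps, Fin.val_zero, Function.iterate_zero, id, Function.comp_apply,
        Fin.val_succ, Function.iterate_succ] at this ⊢
      rw [this, hib]
  intro a ha
  refine mem_iUnion.2 ⟨fun k => i (b^[k] ⟨a, ha⟩), mem_iInter.2 fun n => ?_⟩
  exact ⟨_, hAX (b^[n + 1] ⟨a, ha⟩).2, key (n + 1) ⟨a, ha⟩⟩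

namespace IsQuasiSimilarIFS

variable {d : ℕ} {I : Type} {X : Set (EuclideanSpace ℝ (Fin d))}
  {S : I → EuclideanSpace ℝ (Fin d) → EuclideanSpace ℝ (Fin d)} {ρ : List I → ℝ} {K A c : ℝ}

lemma ratio_le_one (h : IsQuasiSimilarIFS X S ρ K A c) (w : List I) : ρ w ≤ 1 :=
  (h.ratio_le w).trans (pow_le_one₀ h.c_pos.le h.c_lt_one.le)

lemma injOn (h : IsQuasiSimilarIFS X S ρ K A c) (w : List I) : InjOn (compMaps S w) X := by
  intro x hx y hy hxy
  have := h.le_dist w x hx y hy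
  rw [hxy, dist_self, mul_zero] at this
  have h2 : dist x y ≤ 0 := by
    by_contra! h3
    exact absurd (mul_pos (h.ratio_pos w) h3) (not_lt.2 this)
  exact dist_le_zero.1 h2

lemma continuousOn (h : IsQuasiSimilarIFS X S ρ K A c) (w : List I) :
    ContinuousOn (compMaps S w) X := by
  have : LipschitzOnWith (Real.toNNReal (A * ρ w)) (compMaps S w) X :=
    LipschitzOnWith.of_dist_le_mul fun x hx y hy => by
      rw [Real.coe_toNNReal _ (mul_nonneg (by linarith [h.one_le_A]) (h.ratio_pos w).le)]
      exact h.dist_le w x hx y hy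
  exact this.continuousOn

lemma image_interior_word (h : IsQuasiSimilarIFS X S ρ K A c) (w : List I) :
    compMaps S w '' interior X ⊆ interior X :=
  (compMaps_mapsTo (fun i => mapsTo_iff_image_subset.2 (h.image_interior i)) w).image_subset

lemma disjoint_of_not_prefix (h : IsQuasiSimilarIFS X S ρ K A c) :
    ∀ w v : List I, ¬ w <+: v → ¬ v <+: w →
      Disjoint (compMaps S w '' interior X) (compMaps S v '' interior X)
  | [], v, h1, _ => absurd (List.nil_prefix) h1
  | i :: w, [], _, h2 => absurd (List.nil_prefix) h2
  | i :: w, j :: v, h1, h2 => by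
    simp only [compMaps, image_comp]
    by_cases hij : i = j
    · subst hij
      have ih := disjoint_of_not_prefix h w v (fun h' => h1 ((List.prefix_cons_inj i).2 h'))
        (fun h' => h2 ((List.prefix_cons_inj i).2 h'))
      have hinj := h.injOn [i]
      refine disjoint_image_image fun x hx y hy hxy => ?_
      have := hinj (interior_subset (h.image_interior_word w hx))
        (interior_subset (h.image_interior_word v hy)) hxy
      exact disjoint_left.1 ih hx (this ▸ hy)
    · exact (h.disjoint i j hij).mono (image_mono (h.image_interior_word w))
        (image_mono (h.image_interior_word v))

/-- The words of a fixed length in a given set form again such a system. -/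
lemma iterate (h : IsQuasiSimilarIFS X S ρ K A c) {n : ℕ} (hn : 1 ≤ n) {W : Set (List I)}
    (hW : ∀ w ∈ W, w.length = n) :
    IsQuasiSimilarIFS X (fun w : W => compMaps S w)
      (fun l => ρ (l.map Subtype.val).flatten) K A c where
  isCompact := h.isCompact
  nonempty_interior := h.nonempty_interior
  mapsTo w := compMaps_mapsTo h.mapsTo w
  image_interior w := h.image_interior_word w
  disjoint w v hwv := by
    have hne : w.1 ≠ v.1 := fun he => hwv (Subtype.ext he)
    refine h.disjoint_of_not_prefix _ _ (fun hp => hne ?_) (fun hp => hne ?_)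
    · exact hp.eq_of_length (by rw [hW _ w.2, hW _ v.2])
    · exact (hp.eq_of_length (by rw [hW _ w.2, hW _ v.2])).symm
  one_le_K := h.one_le_K
  one_le_A := h.one_le_A
  c_pos := h.c_pos
  c_lt_one := h.c_lt_one
  ratio_nil := h.ratio_nil
  ratio_pos w := h.ratio_pos _
  ratio_le l := by
    refine (h.ratio_le _).trans (pow_le_pow_of_le_one h.c_pos.le h.c_lt_one.le ?_)
    induction l with
    | nil => simp
    | cons w l ih =>
      have := hW w w.2
      simp only [List.length_cons, List.map_cons, List.flatten_cons, List.length_append] at *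
      omega
  ratio_append w v := by
    rw [List.map_append, List.flatten_append]
    exact h.ratio_append _ _
  dist_le l := by rw [compMaps_flatten]; exact h.dist_le _
  le_dist l := by rw [compMaps_flatten]; exact h.le_dist _

end IsQuasiSimilarIFS

namespace IsQuasiSimilarIFS

variable {d : ℕ} {I : Type} {X : Set (EuclideanSpace ℝ (Fin d))}
  {S : I → EuclideanSpace ℝ (Fin d) → EuclideanSpace ℝ (Fin d)} {ρ : List I → ℝ} {K A c : ℝ}

lemma hausdorffMeasure_interior_le (h : IsQuasiSimilarIFS X S ρ K A c) (w : List I) {β : ℝ}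
    (hβ : 0 < β) (hβw : β ≤ ρ w) :
    μH[d] (interior X) ≤ ENNReal.ofReal (A / β) ^ (d : ℝ) *
      μH[d] (compMaps S w '' interior X) := by
  have hanti : AntilipschitzWith (Real.toNNReal (A / β)) fun x : X => compMaps S w x := by
    refine AntilipschitzWith.of_le_mul_dist fun x y => ?_
    rw [Real.coe_toNNReal _ (div_nonneg (by linarith [h.one_le_A]) hβ.le), Subtype.dist_eq,
      div_mul_eq_mul_div, le_div_iff₀ hβ, mul_comm]
    exact (mul_le_mul_of_nonneg_right hβw dist_nonneg).trans (h.le_dist w x x.2 y y.2)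
  have h1 := hanti.le_hausdorffMeasure_image (Nat.cast_nonneg d) ((↑) ⁻¹' interior X : Set X)
  rw [← (isometry_subtype_coe (s := X)).hausdorffMeasure_image (Or.inl (Nat.cast_nonneg d)),
    Subtype.image_preimage_coe, inter_eq_right.2 interior_subset] at h1
  refine h1.trans (mul_le_mul_right (measure_mono ?_) _)
  rintro _ ⟨x, hx, rfl⟩
  exact ⟨x, hx, rfl⟩

/-- Boundedly many pairwise incomparable cylinders of size at least `β` fit into a ball of
radius comparable to `β`. -/
lemma exists_card_le (h : IsQuasiSimilarIFS X S ρ K A c) {C : ℝ} (hC : 0 ≤ C) :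
    ∃ N : ℕ, ∀ (Q : Finset (List I)) (β : ℝ) (z : EuclideanSpace ℝ (Fin d)), 0 < β →
      (∀ w ∈ Q, ∀ v ∈ Q, w ≠ v → ¬ w <+: v) → (∀ w ∈ Q, β ≤ ρ w) →
      (∀ w ∈ Q, compMaps S w '' X ⊆ closedBall z (C * β)) → Q.card ≤ N := by
  set m := (μH[d] (interior X) : ENNReal) with hm
  set M := (μH[d] (closedBall (0 : EuclideanSpace ℝ (Fin d)) 1) : ENNReal) with hM
  have hm0 : m ≠ 0 := (isOpen_interior.measure_pos _ h.nonempty_interior).ne'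
  have hmt : m ≠ ⊤ :=
    ((measure_mono interior_subset).trans_lt h.isCompact.measure_lt_top).ne
  have hMt : M ≠ ⊤ := (isCompact_closedBall _ _).measure_lt_top.ne
  have hA : 0 ≤ A := by linarith [h.one_le_A]
  set R : ENNReal := ENNReal.ofReal (A * C) ^ d * M / m
  have hR : R ≠ ⊤ := ENNReal.div_ne_top (ENNReal.mul_ne_top (by simp) hMt) hm0
  refine ⟨⌊R.toReal⌋₊, fun Q β z hβ hQ hQβ hQz => Nat.le_floor ?_⟩
  rw [← ENNReal.toReal_natCast]
  refine ENNReal.toReal_mono hR ?_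
  rw [ENNReal.le_div_iff_mul_le (Or.inl hm0) (Or.inl hmt)]
  have hmeas : ∀ w, MeasurableSet (compMaps S w '' interior X) := fun w =>
    isOpen_interior.measurableSet.image_of_continuousOn_injOn
      ((h.continuousOn w).mono interior_subset) ((h.injOn w).mono interior_subset)
  calc (Q.card : ENNReal) * m = ∑ w ∈ Q, m := by simp
    _ ≤ ∑ w ∈ Q, ENNReal.ofReal (A / β) ^ (d : ℝ) * μH[d] (compMaps S w '' interior X) :=
        Finset.sum_le_sum fun w hw => h.hausdorffMeasure_interior_le w hβ (hQβ w hw)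
    _ = ENNReal.ofReal (A / β) ^ (d : ℝ) *
          μH[d] (⋃ w ∈ Q, compMaps S w '' interior X) := by
        rw [← Finset.mul_sum, measure_biUnion_finset _ fun w _ => hmeas w]
        intro w hw v hv hwv
        exact h.disjoint_of_not_prefix w v (hQ w hw v hv hwv) (hQ v hv w hw hwv.symm)
    _ ≤ ENNReal.ofReal (A / β) ^ (d : ℝ) * μH[d] (closedBall z (C * β)) := by
        refine mul_le_mul_right (measure_mono (iUnion₂_subset fun w hw => ?_)) _
        exact (image_mono interior_subset).trans (hQz w hw)
    _ = ENNReal.ofReal (A * C) ^ d * M := by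
        rw [Measure.addHaar_closedBall' _ _ (by positivity), finrank_euclideanSpace_fin,
          ENNReal.rpow_natCast, ← ENNReal.ofReal_pow (by positivity), ← mul_assoc,
          ← ENNReal.ofReal_mul (by positivity), ← mul_pow, ← ENNReal.ofReal_pow (by positivity)]
        congr 3
        field_simp

end IsQuasiSimilarIFS

/-- The prefix of length `n` of a sequence. -/
def seqPrefix {I : Type*} (γ : ℕ → I) (n : ℕ) : List I := List.ofFn fun k : Fin n => γ k

@[simp] lemma length_seqPrefix {I : Type*} (γ : ℕ → I) (n : ℕ) : (seqPrefix γ n).length = n := by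
  simp [seqPrefix]

lemma seqPrefix_succ {I : Type*} (γ : ℕ → I) (n : ℕ) :
    seqPrefix γ (n + 1) = γ 0 :: seqPrefix (fun k => γ (k + 1)) n := by
  simp [seqPrefix, List.ofFn_succ]

lemma seqPrefix_succ' {I : Type*} (γ : ℕ → I) (n : ℕ) :
    seqPrefix γ (n + 1) = seqPrefix γ n ++ [γ n] := by
  rw [seqPrefix, List.ofFn_succ_last]
  rfl

lemma take_seqPrefix {I : Type*} (γ : ℕ → I) {j n : ℕ} (hj : j ≤ n) :
    (seqPrefix γ n).take j = seqPrefix γ j := by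
  refine List.ext_getElem (by simpa using hj) fun k h1 h2 => ?_
  simp [seqPrefix]

/-- The words at which the ratio first drops to `δ`. -/
def stopWords {I : Type*} (ρ : List I → ℝ) (δ : ℝ) : Set (List I) :=
  {w | ρ w ≤ δ ∧ ∀ j < w.length, δ < ρ (w.take j)}

lemma stopWords_not_prefix {I : Type*} {ρ : List I → ℝ} {δ : ℝ} {w v : List I}
    (hw : w ∈ stopWords ρ δ) (hv : v ∈ stopWords ρ δ) (hwv : w ≠ v) : ¬ w <+: v := by
  intro hp
  have h1 := hv.2 w.length (lt_of_le_of_ne hp.length_le fun he => hwv (hp.eq_of_length he))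
  rw [← List.prefix_iff_eq_take.1 hp] at h1
  exact absurd hw.1 (not_le.2 h1)

lemma limitSetOf_eq {α I : Type*} (X : Set α) (S : I → α → α) :
    limitSetOf X S = ⋃ γ : ℕ → I, ⋂ n : ℕ, compMaps S (seqPrefix γ (n + 1)) '' X := rfl

lemma image_compMaps_subset_limitSetOf {α I : Type*} {X B : Set α} {S : I → α → α}
    (hS : ∀ i, MapsTo (S i) X X) (hBX : B ⊆ X)
    (hB : ∀ x ∈ B, ∃ (i : I) (w : List I), x ∈ compMaps S (i :: w) '' B) (v : List I) :
    compMaps S v '' B ⊆ limitSetOf X S := by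
  have key : (⋃ v, compMaps S v '' B) ⊆ limitSetOf X S := by
    refine mem_limitSetOf_of_subset
      (iUnion_subset fun v => (image_mono hBX).trans (compMaps_mapsTo hS v).image_subset) ?_
    refine iUnion_subset fun v => ?_
    rintro _ ⟨x, hx, rfl⟩
    cases v with
    | nil =>
      obtain ⟨i, w, y, hy, rfl⟩ := hB x hx
      exact mem_iUnion.2 ⟨i, compMaps S w y, mem_iUnion.2 ⟨w, y, hy, rfl⟩, rfl⟩
    | cons i w => exact mem_iUnion.2 ⟨i, compMaps S w x, mem_iUnion.2 ⟨w, x, hx, rfl⟩, rfl⟩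
  exact (subset_iUnion (fun v => compMaps S v '' B) v).trans key

namespace IsQuasiSimilarIFS

variable {d : ℕ} {I : Type} {X : Set (EuclideanSpace ℝ (Fin d))}
  {S : I → EuclideanSpace ℝ (Fin d) → EuclideanSpace ℝ (Fin d)} {ρ : List I → ℝ} {K A c : ℝ}

lemma limitSetOf_subset (h : IsQuasiSimilarIFS X S ρ K A c) : limitSetOf X S ⊆ X := by
  refine iUnion_subset fun γ => (iInter_subset _ 0).trans ?_
  exact (compMaps_mapsTo h.mapsTo _).image_subset

lemma exists_mem_image_of_mem_limitSetOf (h : IsQuasiSimilarIFS X S ρ K A c)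
    {x : EuclideanSpace ℝ (Fin d)} (hx : x ∈ limitSetOf X S) :
    ∃ i, x ∈ S i '' limitSetOf X S := by
  rw [limitSetOf_eq] at hx
  obtain ⟨γ, hγ⟩ := mem_iUnion.1 hx
  have h1 : ∀ n, ∃ y ∈ compMaps S (seqPrefix (fun k => γ (k + 1)) n) '' X, S (γ 0) y = x := by
    intro n
    obtain ⟨z, hz, hzx⟩ := mem_iInter.1 hγ n
    rw [seqPrefix_succ] at hzx
    exact ⟨_, ⟨z, hz, rfl⟩, hzx⟩
  choose y hy hyx using h1
  have hyX : ∀ n, y n ∈ X := fun n => (compMaps_mapsTo h.mapsTo _).image_subset (hy n)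
  have heq : ∀ n, y n = y 0 := fun n =>
    h.injOn [γ 0] (hyX n) (hyX 0) ((hyx n).trans (hyx 0).symm)
  refine ⟨γ 0, y 0, mem_iUnion.2 ⟨fun k => γ (k + 1), mem_iInter.2 fun n => ?_⟩, hyx 0⟩
  exact heq (n + 1) ▸ hy (n + 1)

lemma limitSetOf_iterate_subset (h : IsQuasiSimilarIFS X S ρ K A c) {n : ℕ} (hn : 1 ≤ n)
    {W : Set (List I)} (hW : ∀ w ∈ W, w.length = n) :
    limitSetOf X (fun w : W => compMaps S w) ⊆ limitSetOf X S := by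
  have h' := h.iterate hn hW
  have := image_compMaps_subset_limitSetOf h.mapsTo h'.limitSetOf_subset (fun x hx => ?_) []
  · simpa [compMaps] using this
  · obtain ⟨⟨w, hw⟩, hxw⟩ := h'.exists_mem_image_of_mem_limitSetOf hx
    cases w with
    | nil => have := hW _ hw; simp at this; omega
    | cons i w => exact ⟨i, w, hxw⟩

lemma exists_stopWords (h : IsQuasiSimilarIFS X S ρ K A c) {δ : ℝ} (hδ : 0 < δ) (γ : ℕ → I) :
    ∃ n, seqPrefix γ n ∈ stopWords ρ δ := by
  classical
  have hex : ∃ n, ρ (seqPrefix γ n) ≤ δ := by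
    obtain ⟨n, hn⟩ := exists_pow_lt_of_lt_one hδ h.c_lt_one
    exact ⟨n, (h.ratio_le _).trans (by simpa using hn.le)⟩
  refine ⟨Nat.find hex, Nat.find_spec hex, fun j hj => ?_⟩
  rw [length_seqPrefix] at hj
  rw [take_seqPrefix γ hj.le]
  exact not_le.1 (Nat.find_min hex hj)

lemma finite_stopWords [Finite I] (h : IsQuasiSimilarIFS X S ρ K A c) {δ : ℝ} (hδ : 0 < δ) :
    (stopWords ρ δ).Finite := by
  obtain ⟨n, hn⟩ := exists_pow_lt_of_lt_one hδ h.c_lt_one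
  refine (List.finite_length_le I n).subset fun w hw => ?_
  by_contra hlen
  have hlen : n < w.length := not_le.1 hlen
  have h1 := hw.2 n hlen
  have h2 := h.ratio_le (w.take n)
  rw [List.length_take, min_eq_left hlen.le] at h2
  linarith

lemma le_ratio_of_mem_stopWords (h : IsQuasiSimilarIFS X S ρ K A c) {δ b : ℝ} (hb : 0 < b)
    (hb1 : b ≤ 1) (hbρ : ∀ i, b ≤ ρ [i]) (hδ : 0 < δ) (hδ1 : δ ≤ 1) {w : List I}
    (hw : w ∈ stopWords ρ δ) : b / K * δ ≤ ρ w := by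
  have hK := h.one_le_K
  rw [div_mul_eq_mul_div, div_le_iff₀ (by linarith)]
  rcases List.eq_nil_or_concat w with rfl | ⟨v, i, rfl⟩
  · rw [h.ratio_nil]
    nlinarith
  · rw [List.concat_eq_append] at hw ⊢
    have h1 := hw.2 v.length (by simp)
    rw [List.take_left' rfl] at h1
    have h2 := h.ratio_append v [i]
    have h3 := hbρ i
    nlinarith [h.ratio_pos v]

end IsQuasiSimilarIFS

namespace IsQuasiSimilarIFS

variable {d : ℕ} {I : Type} {X : Set (EuclideanSpace ℝ (Fin d))}
  {S : I → EuclideanSpace ℝ (Fin d) → EuclideanSpace ℝ (Fin d)} {ρ : List I → ℝ} {K A c : ℝ}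

/-- A Bernoulli measure whose mass on a cylinder is at most the `t`-th power of its ratio. -/
lemma exists_measure_cylinder_le [Fintype I] [MeasurableSpace I] [MeasurableSingletonClass I]
    (h : IsQuasiSimilarIFS X S ρ K A c) {t : ℝ} (ht : 0 ≤ t)
    (hsum : 1 ≤ ∑ i, (ρ [i] / K) ^ t) :
    ∃ P : Measure (ℕ → I), IsProbabilityMeasure P ∧
      ∀ w : List I, P {γ | seqPrefix γ w.length = w} ≤ ENNReal.ofReal (ρ w ^ t) := by
  have hK : 0 < K := by linarith [h.one_le_K]
  set Z := ∑ i, (ρ [i] / K) ^ t with hZ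
  have hZ0 : 0 < Z := by linarith
  have hq : ∀ i, 0 ≤ (ρ [i] / K) ^ t := fun i =>
    Real.rpow_nonneg (div_nonneg (h.ratio_pos _).le hK.le) _
  set p : I → ENNReal := fun i => ENNReal.ofReal ((ρ [i] / K) ^ t / Z) with hp
  have hp1 : ∑ i, p i = 1 := by
    rw [hp, ← ENNReal.ofReal_sum_of_nonneg fun i _ => div_nonneg (hq i) hZ0.le,
      ← Finset.sum_div, ← hZ, div_self hZ0.ne', ENNReal.ofReal_one]
  set μ : Measure I := (PMF.ofFintype p hp1).toMeasure with hμ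
  have hμi : ∀ i, μ {i} = p i := fun i => by
    rw [hμ, PMF.toMeasure_apply_singleton _ _ (measurableSet_singleton i), PMF.ofFintype_apply]
  refine ⟨Measure.infinitePi fun _ => μ, inferInstance, fun w => ?_⟩
  have hset : {γ : ℕ → I | seqPrefix γ w.length = w} =
      Set.pi (Finset.range w.length) fun j => {i | w[j]? = some i} := by
    ext γ
    simp only [Set.mem_ofPred_eq, Set.mem_pi, Finset.coe_range, mem_Iio]
    constructor
    · intro hγ j hj
      have := congrArg (fun l => l[j]?) hγ
      simp [seqPrefix, hj] at this
      simp [← this, hj]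
    · intro hγ
      refine List.ext_getElem (by simp) fun j h1 h2 => ?_
      have := hγ j h2
      rw [List.getElem?_eq_getElem h2, Option.some_inj] at this
      simp [seqPrefix, this]
  have hmeas : ∀ s : Set I, MeasurableSet s := fun s => s.toFinite.measurableSet
  rw [hset, Measure.infinitePi_pi _ fun j _ => hmeas _]
  clear hset
  induction w with
  | nil => simp [h.ratio_nil]
  | cons i w ih =>
    rw [List.length_cons, Finset.prod_range_succ']
    simp only [List.getElem?_cons_succ, List.getElem?_cons_zero, Option.some_inj]
    have h1 : {j : I | i = j} = {i} := by ext; simp [eq_comm]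
    rw [h1, hμi]
    refine (mul_le_mul_left ih _).trans ?_
    rw [hp, ← ENNReal.ofReal_mul (Real.rpow_nonneg (h.ratio_pos _).le _)]
    refine ENNReal.ofReal_le_ofReal ?_
    have h2 := h.ratio_append [i] w
    have h3 : (ρ [i] / K) ^ t / Z ≤ (ρ [i] / K) ^ t := div_le_self (hq i) hsum
    calc ρ w ^ t * ((ρ [i] / K) ^ t / Z) ≤ ρ w ^ t * (ρ [i] / K) ^ t :=
          mul_le_mul_of_nonneg_left h3 (Real.rpow_nonneg (h.ratio_pos _).le _)
      _ = (ρ w * (ρ [i] / K)) ^ t :=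
          (Real.mul_rpow (h.ratio_pos _).le (div_nonneg (h.ratio_pos _).le hK.le)).symm
      _ ≤ ρ (i :: w) ^ t := by
          refine Real.rpow_le_rpow (mul_nonneg (h.ratio_pos _).le
            (div_nonneg (h.ratio_pos _).le hK.le)) ?_ ht
          rw [mul_div_assoc', div_le_iff₀ hK]
          simp only [List.singleton_append] at h2
          linarith

end IsQuasiSimilarIFS

namespace IsQuasiSimilarIFS

variable {d : ℕ} {I : Type} {X : Set (EuclideanSpace ℝ (Fin d))}
  {S : I → EuclideanSpace ℝ (Fin d) → EuclideanSpace ℝ (Fin d)} {ρ : List I → ℝ} {K A c : ℝ}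

lemma dist_le_of_mem_image (h : IsQuasiSimilarIFS X S ρ K A c) {w : List I}
    {x y : EuclideanSpace ℝ (Fin d)} (hx : x ∈ compMaps S w '' X) (hy : y ∈ compMaps S w '' X) :
    dist x y ≤ A * diam X * ρ w := by
  obtain ⟨x, hx, rfl⟩ := hx
  obtain ⟨y, hy, rfl⟩ := hy
  refine (h.dist_le w x hx y hy).trans ?_
  rw [mul_right_comm]
  refine mul_le_mul_of_nonneg_right (mul_le_mul_of_nonneg_left
    (dist_le_diam_of_mem h.isCompact.isBounded hx hy) ?_) (h.ratio_pos w).le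
  linarith [h.one_le_A]

lemma diam_nonneg' (h : IsQuasiSimilarIFS X S ρ K A c) : 0 ≤ A * diam X :=
  mul_nonneg (by linarith [h.one_le_A]) diam_nonneg

lemma exists_pos_le_ratio [Finite I] (h : IsQuasiSimilarIFS X S ρ K A c) :
    ∃ b, 0 < b ∧ b ≤ 1 ∧ ∀ i, b ≤ ρ [i] := by
  rcases isEmpty_or_nonempty I with hI | hI
  · exact ⟨1, one_pos, le_rfl, fun i => (hI.false i).elim⟩
  · obtain ⟨i, hi⟩ := Finite.exists_min fun i => ρ [i]
    exact ⟨ρ [i], h.ratio_pos _, h.ratio_le_one _, hi⟩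

/-- The coding map of the limit set. -/
lemma exists_coding [Finite I] [MeasurableSpace I] [MeasurableSingletonClass I]
    (h : IsQuasiSimilarIFS X S ρ K A c) :
    ∃ code : (ℕ → I) → EuclideanSpace ℝ (Fin d), Measurable code ∧
      (∀ γ n, code γ ∈ compMaps S (seqPrefix γ n) '' X) ∧ ∀ γ, code γ ∈ limitSetOf X S := by
  obtain ⟨x₀, hx₀'⟩ := h.nonempty_interior
  have hx₀ : x₀ ∈ X := interior_subset hx₀'
  have hne : ∀ γ : ℕ → I, (⋂ n, compMaps S (seqPrefix γ n) '' X).Nonempty := by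
    intro γ
    have hcpt : ∀ n, IsCompact (compMaps S (seqPrefix γ n) '' X) := fun n =>
      h.isCompact.image_of_continuousOn (h.continuousOn _)
    refine IsCompact.nonempty_iInter_of_sequence_nonempty_isCompact_isClosed _ (fun n => ?_)
      (fun n => ⟨_, mem_image_of_mem _ hx₀⟩) (hcpt 0) fun n => (hcpt n).isClosed
    rw [seqPrefix_succ', compMaps_append, image_comp]
    exact image_mono (compMaps_mapsTo h.mapsTo _).image_subset
  choose code hcode using hne
  have hmem : ∀ γ n, code γ ∈ compMaps S (seqPrefix γ n) '' X := fun γ n =>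
    mem_iInter.1 (hcode γ) n
  refine ⟨code, ?_, hmem, fun γ => mem_iUnion.2 ⟨γ, mem_iInter.2 fun n => hmem γ (n + 1)⟩⟩
  refine measurable_of_tendsto_metrizable
    (f := fun (n : ℕ) (γ : ℕ → I) => compMaps S (seqPrefix γ n) x₀) (fun n => ?_) ?_
  · have hG : Measurable fun u : Fin n → I => compMaps S (List.ofFn u) x₀ :=
      Measurable.of_discrete
    exact hG.comp (measurable_pi_lambda _ fun k => measurable_pi_apply _)
  · refine tendsto_pi_nhds.2 fun γ => ?_
    rw [tendsto_iff_dist_tendsto_zero]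
    have hlim : Tendsto (fun n => A * diam X * c ^ n) atTop (𝓝 0) := by
      simpa using (tendsto_pow_atTop_nhds_zero_of_lt_one h.c_pos.le h.c_lt_one).const_mul
        (A * diam X)
    refine squeeze_zero (fun _ => dist_nonneg) (fun n => ?_) hlim
    refine (h.dist_le_of_mem_image (mem_image_of_mem _ hx₀) (hmem γ n)).trans ?_
    refine mul_le_mul_of_nonneg_left ?_ h.diam_nonneg'
    simpa using h.ratio_le (seqPrefix γ n)

lemma one_le_card_stopWords_mul [Fintype I] (h : IsQuasiSimilarIFS X S ρ K A c) {t : ℝ}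
    (ht : 0 ≤ t) (hsum : 1 ≤ ∑ i, (ρ [i] / K) ^ t) {δ : ℝ} (hδ : 0 < δ) :
    1 ≤ ((h.finite_stopWords hδ).toFinset.card : ℝ) * δ ^ t := by
  let _ : MeasurableSpace I := ⊤
  obtain ⟨P, hP, hPw⟩ := h.exists_measure_cylinder_le ht hsum
  set Q := (h.finite_stopWords hδ).toFinset with hQ
  have hcov : (univ : Set (ℕ → I)) ⊆ ⋃ w ∈ Q, {γ | seqPrefix γ w.length = w} := by
    intro γ _
    obtain ⟨n, hn⟩ := h.exists_stopWords hδ γ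
    exact mem_iUnion₂.2 ⟨_, (Set.Finite.mem_toFinset _).2 hn, by simp⟩
  have h1 : (1 : ENNReal) ≤ ENNReal.ofReal (Q.card * δ ^ t) := by
    calc (1 : ENNReal) = P univ := measure_univ.symm
      _ ≤ ∑ w ∈ Q, P {γ | seqPrefix γ w.length = w} :=
        (measure_mono hcov).trans (measure_biUnion_finset_le _ _)
      _ ≤ ∑ w ∈ Q, ENNReal.ofReal (δ ^ t) := by
        refine Finset.sum_le_sum fun w hw => (hPw w).trans (ENNReal.ofReal_le_ofReal ?_)
        exact Real.rpow_le_rpow (h.ratio_pos w).le ((Set.Finite.mem_toFinset _).1 hw).1 ht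
      _ = ENNReal.ofReal (Q.card * δ ^ t) := by
        rw [Finset.sum_const, nsmul_eq_mul, ENNReal.ofReal_mul (by positivity),
          ENNReal.ofReal_natCast]
  rwa [← ENNReal.ofReal_one, ENNReal.ofReal_le_ofReal_iff (by positivity)] at h1

lemma le_dimH_limitSetOf_of_fintype [Fintype I] (h : IsQuasiSimilarIFS X S ρ K A c) {t : ℝ}
    (ht : 0 < t) (hsum : 1 ≤ ∑ i, (ρ [i] / K) ^ t) :
    ENNReal.ofReal t ≤ dimH (limitSetOf X S) := by
  classical
  let _ : MeasurableSpace I := ⊤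
  obtain ⟨P, hP, hPw⟩ := h.exists_measure_cylinder_le ht.le hsum
  obtain ⟨code, hmeas, hcode, hcodeΛ⟩ := h.exists_coding
  obtain ⟨b, hb, hb1, hbρ⟩ := h.exists_pos_le_ratio
  have hK : 0 < K := by linarith [h.one_le_K]
  have hAD := h.diam_nonneg'
  obtain ⟨N, hN⟩ := h.exists_card_le (C := (A * diam X + 1) * (K / b)) (by positivity)
  have key : ∀ s : Set (EuclideanSpace ℝ (Fin d)), ∀ δ : ℝ, 0 < δ → δ ≤ 1 →
      ediam s ≤ ENNReal.ofReal δ → P.map code s ≤ N * ENNReal.ofReal (δ ^ t) := by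
    intro s δ hδ hδ1 hs
    rw [← ediam_closure] at hs
    refine (measure_mono subset_closure).trans ?_
    rcases (closure s).eq_empty_or_nonempty with he | ⟨z, hz⟩
    · simp [he]
    rw [Measure.map_apply hmeas isClosed_closure.measurableSet]
    set Q := (h.finite_stopWords hδ).toFinset.filter
      fun w => (compMaps S w '' X ∩ closure s).Nonempty with hQ
    have hQs : ∀ w ∈ Q, w ∈ stopWords ρ δ := fun w hw =>
      (Set.Finite.mem_toFinset _).1 (Finset.mem_filter.1 hw).1
    have hcov : code ⁻¹' closure s ⊆ ⋃ w ∈ Q, {γ | seqPrefix γ w.length = w} := by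
      intro γ hγ
      obtain ⟨n, hn⟩ := h.exists_stopWords hδ γ
      refine mem_iUnion₂.2 ⟨_, Finset.mem_filter.2 ⟨(Set.Finite.mem_toFinset _).2 hn, ?_⟩,
        by simp⟩
      exact ⟨code γ, hcode γ n, hγ⟩
    have hcard : Q.card ≤ N := by
      refine hN Q (b / K * δ) z (by positivity)
        (fun w hw v hv => stopWords_not_prefix (hQs w hw) (hQs v hv))
        (fun w hw => h.le_ratio_of_mem_stopWords hb hb1 hbρ hδ hδ1 (hQs w hw)) fun w hw => ?_
      intro x hx
      obtain ⟨y, hy, hys⟩ := (Finset.mem_filter.1 hw).2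
      have h1 := h.dist_le_of_mem_image hx hy
      have h2 : dist y z ≤ δ := by
        rw [← ENNReal.ofReal_le_ofReal_iff hδ.le, ← edist_dist]
        exact (edist_le_ediam_of_mem hys hz).trans hs
      have h3 : A * diam X * ρ w ≤ A * diam X * δ := mul_le_mul_of_nonneg_left (hQs w hw).1 hAD
      rw [mem_closedBall]
      calc dist x z ≤ dist x y + dist y z := dist_triangle _ _ _
        _ ≤ (A * diam X + 1) * δ := by linarith
        _ = (A * diam X + 1) * (K / b) * (b / K * δ) := by field_simp
    calc P (code ⁻¹' closure s) ≤ ∑ w ∈ Q, P {γ | seqPrefix γ w.length = w} :=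
          (measure_mono hcov).trans (measure_biUnion_finset_le _ _)
      _ ≤ ∑ w ∈ Q, ENNReal.ofReal (δ ^ t) := by
          refine Finset.sum_le_sum fun w hw => (hPw w).trans (ENNReal.ofReal_le_ofReal ?_)
          exact Real.rpow_le_rpow (h.ratio_pos w).le (hQs w hw).1 ht.le
      _ ≤ N * ENNReal.ofReal (δ ^ t) := by
          rw [Finset.sum_const, nsmul_eq_mul]
          gcongr
  have key2 : ∀ s : Set (EuclideanSpace ℝ (Fin d)), ediam s ≤ ENNReal.ofReal 2⁻¹ →
      P.map code s ≤ (N + 1) * ediam s ^ t := by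
    intro s hs
    have hst : ediam s ≠ ⊤ := (hs.trans_lt ENNReal.ofReal_lt_top).ne
    obtain ⟨e, he0, he⟩ : ∃ e : ℝ, 0 ≤ e ∧ ediam s = ENNReal.ofReal e :=
      ⟨_, ENNReal.toReal_nonneg, (ENNReal.ofReal_toReal hst).symm⟩
    rw [he] at hs ⊢
    have he1 : e ≤ 2⁻¹ := (ENNReal.ofReal_le_ofReal_iff (by norm_num)).1 hs
    rw [ENNReal.ofReal_rpow_of_nonneg he0 ht.le]
    have hlim : Tendsto (fun δ : ℝ => (N : ENNReal) * ENNReal.ofReal (δ ^ t)) (𝓝[>] e)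
        (𝓝 (N * ENNReal.ofReal (e ^ t))) := by
      refine ENNReal.Tendsto.const_mul ?_ (Or.inr (by simp))
      refine (ENNReal.continuous_ofReal.tendsto _).comp ?_
      exact ((Real.continuousAt_rpow_const e t (Or.inr ht.le)).tendsto).mono_left
        nhdsWithin_le_nhds
    have h1 : P.map code s ≤ N * ENNReal.ofReal (e ^ t) := by
      refine ge_of_tendsto hlim ?_
      filter_upwards [Ioo_mem_nhdsGT (show e < 1 by linarith)] with δ hδ
      exact key s δ (he0.trans_lt hδ.1) hδ.2.le (he ▸ ENNReal.ofReal_le_ofReal hδ.1.le)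
    refine h1.trans (mul_le_mul_left ?_ _)
    exact le_self_add
  have hN0 : (N + 1 : ENNReal) ≠ 0 := by simp
  have hNt : (N + 1 : ENNReal) ≠ ⊤ := by finiteness
  have hle : (N + 1 : ENNReal)⁻¹ • P.map code ≤ μH[t] := by
    refine Measure.le_hausdorffMeasure t _ (ENNReal.ofReal 2⁻¹) (by simp) fun s hs => ?_
    rw [Measure.smul_apply, smul_eq_mul, ← ENNReal.div_eq_inv_mul]
    exact ENNReal.div_le_of_le_mul' (key2 s hs)
  have h0 : μH[t] (limitSetOf X S) ≠ 0 := by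
    refine ((ENNReal.inv_pos.2 hNt).trans_le ?_).ne'
    calc (N + 1 : ENNReal)⁻¹ = (N + 1 : ENNReal)⁻¹ * P (code ⁻¹' limitSetOf X S) := by
          rw [show code ⁻¹' limitSetOf X S = univ from eq_univ_of_forall hcodeΛ, measure_univ,
            mul_one]
      _ ≤ (N + 1 : ENNReal)⁻¹ * P.map code (limitSetOf X S) :=
          mul_le_mul_right (Measure.le_map_apply hmeas.aemeasurable _) _
      _ ≤ μH[t] (limitSetOf X S) := hle _
  rw [← Real.coe_toNNReal t ht.le] at h0
  exact le_dimH_of_hausdorffMeasure_ne_zero h0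

end IsQuasiSimilarIFS

namespace IsQuasiSimilarIFS

variable {d : ℕ} {I : Type} {X : Set (EuclideanSpace ℝ (Fin d))}
  {S : I → EuclideanSpace ℝ (Fin d) → EuclideanSpace ℝ (Fin d)} {ρ : List I → ℝ} {K A c : ℝ}

lemma le_dimH_limitSetOf (h : IsQuasiSimilarIFS X S ρ K A c) {t : ℝ} (ht : 0 < t) {n : ℕ}
    (hn : 1 ≤ n) {W : Finset (List I)} (hW : ∀ w ∈ W, w.length = n)
    (hsum : 1 ≤ ∑ w ∈ W, (ρ w / K) ^ t) : ENNReal.ofReal t ≤ dimH (limitSetOf X S) := by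
  have h' := h.iterate hn (W := (W : Set (List I))) hW
  refine (h'.le_dimH_limitSetOf_of_fintype ht ?_).trans
    (dimH_mono (h.limitSetOf_iterate_subset hn hW))
  simp only [List.map_cons, List.map_nil, List.flatten_cons, List.flatten_nil, List.append_nil]
  rw [← Finset.sum_coe_sort] at hsum
  exact hsum

/-- Above the dimension of the limit set, the sums of powers of all ratios are bounded. -/
lemma exists_sum_ratio_le (h : IsQuasiSimilarIFS X S ρ K A c) {t : ℝ} (ht : 0 < t)
    (hdim : dimH (limitSetOf X S) < ENNReal.ofReal t) {t' : ℝ} (htt' : t < t') :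
    ∃ C : ℝ, ∀ G : Finset (List I), ∑ w ∈ G, ρ w ^ t' ≤ C := by
  classical
  have hK : 0 < K := by linarith [h.one_le_K]
  have hKt : 1 ≤ K ^ t := Real.one_le_rpow h.one_le_K ht.le
  have h1 : ∀ (n : ℕ) (W : Finset (List I)), (∀ w ∈ W, w.length = n) →
      ∑ w ∈ W, ρ w ^ t ≤ K ^ t := by
    intro n W hW
    rcases Nat.eq_zero_or_pos n with rfl | hn
    · calc ∑ w ∈ W, ρ w ^ t ≤ ∑ w ∈ {[]}, ρ w ^ t := by
            refine Finset.sum_le_sum_of_subset_of_nonneg (fun w hw => ?_)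
              fun w _ _ => Real.rpow_nonneg (h.ratio_pos w).le _
            simpa using hW w hw
        _ ≤ K ^ t := by simpa [h.ratio_nil] using hKt
    · by_contra! hlt
      refine absurd (h.le_dimH_limitSetOf ht hn hW ?_) (not_le.2 hdim)
      rw [Finset.sum_congr rfl fun w _ => Real.div_rpow (h.ratio_pos w).le hK.le t,
        ← Finset.sum_div, le_div_iff₀ (by linarith), one_mul]
      exact hlt.le
  set q := c ^ (t' - t) with hq
  have hq0 : 0 ≤ q := Real.rpow_nonneg h.c_pos.le _
  have hq1 : q < 1 := Real.rpow_lt_one h.c_pos.le h.c_lt_one (by linarith)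
  refine ⟨K ^ t * (1 - q)⁻¹, fun G => ?_⟩
  set N := G.sup List.length + 1 with hN
  have hmaps : ∀ w ∈ G, w.length ∈ Finset.range N := fun w hw =>
    Finset.mem_range.2 (Nat.lt_succ_of_le (Finset.le_sup (f := List.length) hw))
  rw [← Finset.sum_fiberwise_of_maps_to hmaps]
  calc ∑ n ∈ Finset.range N, ∑ w ∈ G with w.length = n, ρ w ^ t'
      ≤ ∑ n ∈ Finset.range N, K ^ t * q ^ n := by
        refine Finset.sum_le_sum fun n _ => ?_
        calc ∑ w ∈ G with w.length = n, ρ w ^ t'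
            ≤ ∑ w ∈ G with w.length = n, ρ w ^ t * q ^ n := by
              refine Finset.sum_le_sum fun w hw => ?_
              have hlen := (Finset.mem_filter.1 hw).2
              have hr := h.ratio_le w
              rw [hlen] at hr
              rw [show t' = t + (t' - t) by ring, Real.rpow_add (h.ratio_pos w)]
              refine mul_le_mul_of_nonneg_left ?_ (Real.rpow_nonneg (h.ratio_pos w).le _)
              rw [hq, ← Real.rpow_mul_natCast h.c_pos.le, mul_comm, Real.rpow_mul h.c_pos.le,
                Real.rpow_natCast]
              exact Real.rpow_le_rpow (h.ratio_pos w).le hr (by linarith)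
          _ ≤ K ^ t * q ^ n := by
              rw [← Finset.sum_mul]
              exact mul_le_mul_of_nonneg_right
                (h1 n _ fun w hw => (Finset.mem_filter.1 hw).2) (by positivity)
    _ ≤ K ^ t * (1 - q)⁻¹ := by
        rw [← Finset.mul_sum]
        refine mul_le_mul_of_nonneg_left ?_ (by linarith)
        exact (summable_geometric_of_lt_one hq0 hq1).sum_le_tsum _ (fun n _ => by positivity)
          |>.trans_eq (tsum_geometric_of_lt_one hq0 hq1)

/-- Below the dimension of the limit set, some iterate has a large finite subsystem. -/
lemma exists_one_le_sum [Countable I] (h : IsQuasiSimilarIFS X S ρ K A c) {t : ℝ} (ht : 0 < t)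
    (hdim : ENNReal.ofReal t < dimH (limitSetOf X S)) :
    ∃ n ≥ 1, ∃ W : Finset (List I), (∀ w ∈ W, w.length = n) ∧ 1 ≤ ∑ w ∈ W, (ρ w / K) ^ t := by
  by_contra! H
  have hK : 0 < K := by linarith [h.one_le_K]
  have hAD := h.diam_nonneg'
  refine absurd ?_ (not_le.2 hdim)
  rw [ENNReal.ofReal]
  refine dimH_le_of_hausdorffMeasure_ne_top ?_
  rw [Real.coe_toNNReal t ht.le]
  have hediam : ∀ w, ediam (compMaps S w '' X) ≤ ENNReal.ofReal (A * diam X * ρ w) := fun w =>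
    ediam_le fun x hx y hy => by
      rw [edist_dist]
      exact ENNReal.ofReal_le_ofReal (h.dist_le_of_mem_image hx hy)
  have hle := Measure.hausdorffMeasure_le_liminf_tsum
    (ι := fun n : ℕ => {w : List I // w.length = n + 1}) t (limitSetOf X S) (l := atTop) (fun n => ENNReal.ofReal (A * diam X * c ^ (n + 1)))
    ?_ (fun n w => compMaps S w '' X) ?_ ?_
  · refine (hle.trans (liminf_le_of_le (a := ENNReal.ofReal ((A * diam X * K) ^ t)) ?_ ?_)).trans_lt
      ENNReal.ofReal_lt_top |>.ne
    · isBoundedDefault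
    · intro b hb
      obtain ⟨n, hn⟩ := hb.exists
      refine hn.trans ?_
      rw [ENNReal.tsum_eq_iSup_sum]
      refine iSup_le fun s => ?_
      have hs := H (n + 1) (by omega) (s.map (Function.Embedding.subtype _)) fun w hw => by
        obtain ⟨v, -, rfl⟩ := Finset.mem_map.1 hw
        exact v.2
      rw [Finset.sum_map] at hs
      calc ∑ w ∈ s, ediam (compMaps S w '' X) ^ t
          ≤ ∑ w ∈ s, ENNReal.ofReal ((A * diam X * K) ^ t * (ρ w / K) ^ t) := by
            refine Finset.sum_le_sum fun w _ => ?_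
            have hρ := h.ratio_pos w
            refine (ENNReal.rpow_le_rpow (hediam w) ht.le).trans_eq ?_
            rw [ENNReal.ofReal_rpow_of_nonneg (by positivity) ht.le,
              ← Real.mul_rpow (by positivity) (by positivity)]
            congr 2
            field_simp
        _ ≤ ENNReal.ofReal ((A * diam X * K) ^ t) := by
            rw [← ENNReal.ofReal_sum_of_nonneg fun w _ => by
              have hρ := h.ratio_pos w
              positivity, ← Finset.mul_sum]
            exact ENNReal.ofReal_le_ofReal
              (mul_le_of_le_one_right (by positivity) hs.le)
  · rw [← ENNReal.ofReal_zero]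
    refine (ENNReal.continuous_ofReal.tendsto _).comp ?_
    simpa using ((tendsto_add_atTop_iff_nat 1).2
      (tendsto_pow_atTop_nhds_zero_of_lt_one h.c_pos.le h.c_lt_one)).const_mul (A * diam X)
  · refine Eventually.of_forall fun n w => (hediam w).trans (ENNReal.ofReal_le_ofReal ?_)
    have := h.ratio_le w
    rw [w.2] at this
    exact mul_le_mul_of_nonneg_left this hAD
  · refine Eventually.of_forall fun n => iUnion_subset fun γ => ?_
    refine (iInter_subset _ n).trans ?_
    exact subset_iUnion (fun w : {w : List I // w.length = n + 1} => compMaps S w '' X)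
      ⟨List.ofFn fun k : Fin (n + 1) => γ k, by simp⟩

end IsQuasiSimilarIFS

section coveringNumber

variable {α β : Type*} [PseudoMetricSpace α] [PseudoMetricSpace β]

lemma coveringNumber_le_card {E : Set α} {r : ℝ} {T : Finset α} (hT : E ⊆ ⋃ x ∈ T, ball x r) :
    coveringNumber E r ≤ T.card :=
  Nat.sInf_le ⟨T, rfl, hT⟩

lemma exists_card_eq_coveringNumber [ProperSpace α] {E : Set α} (hE : Bornology.IsBounded E)
    {r : ℝ} (hr : 0 < r) :
    ∃ T : Finset α, T.card = coveringNumber E r ∧ E ⊆ ⋃ x ∈ T, ball x r := by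
  have hne : {n : ℕ | ∃ t : Finset α, t.card = n ∧ E ⊆ ⋃ x ∈ t, Metric.ball x r}.Nonempty := by
    obtain ⟨t, ht, hEt⟩ := Metric.totallyBounded_iff.1 
      (hE.isCompact_closure.totallyBounded.subset subset_closure) r hr
    exact ⟨_, ht.toFinset, rfl, by simpa using hEt⟩
  exact Nat.sInf_mem hne

lemma coveringNumber_anti [ProperSpace α] {E : Set α} (hE : Bornology.IsBounded E) {r r' : ℝ}
    (hr : 0 < r) (hrr' : r ≤ r') : coveringNumber E r' ≤ coveringNumber E r := by
  obtain ⟨T, hT, hET⟩ := exists_card_eq_coveringNumber hE hr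
  rw [← hT]
  exact coveringNumber_le_card (hET.trans (iUnion₂_mono fun x _ => ball_subset_ball hrr'))

lemma one_le_coveringNumber [ProperSpace α] {E : Set α} (hE : Bornology.IsBounded E)
    (hne : E.Nonempty) {r : ℝ} (hr : 0 < r) : 1 ≤ coveringNumber E r := by
  obtain ⟨T, hT, hET⟩ := exists_card_eq_coveringNumber hE hr
  obtain ⟨x, hx⟩ := hne
  obtain ⟨y, hy, -⟩ := mem_iUnion₂.1 (hET hx)
  rw [← hT]
  exact Finset.card_pos.2 ⟨y, hy⟩

/-- Transport of a finite cover of the image of one map to the image of another one. -/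
lemma exists_cover_transport {ι : Type*} {B : Set ι} {a : ι → α} {b : ι → β} {r r' : ℝ}
    (hab : ∀ x ∈ B, ∀ y ∈ B, dist (a x) (a y) < 2 * r → dist (b x) (b y) < r')
    {T : Finset α} (hT : a '' B ⊆ ⋃ z ∈ T, ball z r) :
    ∃ Q ⊆ T, (∀ z ∈ Q, (ball z r ∩ a '' B).Nonempty) ∧
      ∃ T' : Finset β, T'.card ≤ Q.card ∧ b '' B ⊆ ⋃ z ∈ T', ball z r' := by
  classical
  set Q := T.filter fun z => (ball z r ∩ a '' B).Nonempty with hQ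
  have hch : ∀ z : Q, ∃ x ∈ B, a x ∈ ball z.1 r := by
    rintro ⟨z, hz⟩
    obtain ⟨_, hx, x, hxB, rfl⟩ := (Finset.mem_filter.1 hz).2
    exact ⟨x, hxB, hx⟩
  choose x hxB hx using hch
  refine ⟨Q, Finset.filter_subset _ _, fun z hz => (Finset.mem_filter.1 hz).2,
    Q.attach.image fun z => b (x z), Finset.card_image_le.trans_eq Q.card_attach, ?_⟩
  rintro _ ⟨y, hy, rfl⟩
  obtain ⟨z, hz, hyz⟩ := mem_iUnion₂.1 (hT ⟨y, hy, rfl⟩)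
  have hzQ : z ∈ Q := Finset.mem_filter.2 ⟨hz, a y, hyz, y, hy, rfl⟩
  refine mem_iUnion₂.2 ⟨b (x ⟨z, hzQ⟩),
    Finset.mem_image.2 ⟨⟨z, hzQ⟩, Finset.mem_attach _ _, rfl⟩, hab y hy _ (hxB _) ?_⟩
  have h1 := hx ⟨z, hzQ⟩
  rw [mem_ball] at hyz h1
  linarith [dist_triangle_right (a y) (a (x ⟨z, hzQ⟩)) z]

lemma exists_coveringNumber_le_mul {E : Type*} [NormedAddCommGroup E] [NormedSpace ℝ E]
    [ProperSpace E] {C : ℝ} (hC : 0 < C) : ∃ M : ℕ, ∀ (s : Set E) (r : ℝ),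
      Bornology.IsBounded s → 0 < r → coveringNumber s r ≤ M * coveringNumber s (C * r) := by
  classical
  obtain ⟨U, -, hU⟩ := exists_card_eq_coveringNumber (isBounded_ball (x := (0 : E)) (r := C))
    one_pos
  refine ⟨U.card, fun s r hs hr => ?_⟩
  obtain ⟨T, hT, hsT⟩ := exists_card_eq_coveringNumber hs (mul_pos hC hr)
  rw [← hT, mul_comm, ← Finset.card_product]
  refine (coveringNumber_le_card (T := (T ×ˢ U).image fun p => p.1 + r • p.2) ?_).trans
    Finset.card_image_le
  intro x hx
  obtain ⟨z, hz, hxz⟩ := mem_iUnion₂.1 (hsT hx)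
  have h1 : r⁻¹ • (x - z) ∈ ball (0 : E) C := by
    rw [mem_ball_zero_iff, norm_smul, norm_inv, Real.norm_of_nonneg hr.le, ← dist_eq_norm,
      inv_mul_lt_iff₀ hr, mul_comm]
    exact hxz
  obtain ⟨u, hu, hxu⟩ := mem_iUnion₂.1 (hU h1)
  refine mem_iUnion₂.2 ⟨z + r • u, Finset.mem_image.2 ⟨(z, u), Finset.mk_mem_product hz hu, rfl⟩, ?_⟩
  have h2 : x - (z + r • u) = r • (r⁻¹ • (x - z) - u) := by
    rw [smul_sub, smul_inv_smul₀ hr.ne']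
    abel
  rw [mem_ball, dist_eq_norm] at hxu ⊢
  rw [h2, norm_smul, Real.norm_of_nonneg hr.le]
  exact mul_lt_of_lt_one_right hr hxu

end coveringNumber

namespace IsQuasiSimilarIFS

variable {d : ℕ} {I : Type} {X : Set (EuclideanSpace ℝ (Fin d))}
  {S : I → EuclideanSpace ℝ (Fin d) → EuclideanSpace ℝ (Fin d)} {ρ : List I → ℝ} {K A c : ℝ}

lemma coveringNumber_limitSetOf_le (h : IsQuasiSimilarIFS X S ρ K A c)
    {F : Set (EuclideanSpace ℝ (Fin d))} (hFX : F ⊆ X) (hF : ∀ i, ∃ p ∈ F, S i p = p) :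
    ∃ M : ℕ, ∀ (r : ℝ) (G : Finset (List I)), 0 < r → r < 1 → (∀ w, r < ρ w → w ∈ G) →
      (∀ w ∈ G, r < ρ w) →
      coveringNumber (limitSetOf X S) r ≤ M * ∑ w ∈ G, coveringNumber F (r / ρ w) := by
  classical
  have hAD := h.diam_nonneg'
  have hA : 0 < A := by linarith [h.one_le_A]
  have hΛ : Bornology.IsBounded (limitSetOf X S) := h.isCompact.isBounded.subset h.limitSetOf_subset
  have hFb : Bornology.IsBounded F := h.isCompact.isBounded.subset hFX
  obtain ⟨M, hM⟩ := exists_coveringNumber_le_mul (E := EuclideanSpace ℝ (Fin d))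
    (show 0 < 2 * A + A * diam X + 1 by positivity)
  refine ⟨M, fun r G hr hr1 hG hGr => (hM _ r hΛ hr).trans (Nat.mul_le_mul_left _ ?_)⟩
  have hcov : ∀ w : List I, ∃ T : Finset (EuclideanSpace ℝ (Fin d)),
      T.card ≤ coveringNumber F (r / ρ w) ∧ compMaps S w '' F ⊆ ⋃ z ∈ T, ball z (2 * A * r) := by
    intro w
    have hρ := h.ratio_pos w
    obtain ⟨T, hT, hFT⟩ := exists_card_eq_coveringNumber hFb (div_pos hr hρ)
    have htr : ∀ x ∈ F, ∀ y ∈ F, dist (id x) (id y) < 2 * (r / ρ w) →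
        dist (compMaps S w x) (compMaps S w y) < 2 * A * r := by
      intro x hx y hy hxy
      refine (h.dist_le w x (hFX hx) y (hFX hy)).trans_lt ?_
      calc A * ρ w * dist x y < A * ρ w * (2 * (r / ρ w)) :=
            mul_lt_mul_of_pos_left hxy (by positivity)
        _ = 2 * A * r := by field_simp
    obtain ⟨Q, hQT, -, T', hT', hcT'⟩ := exists_cover_transport htr (T := T) (by simpa using hFT)
    exact ⟨T', hT'.trans ((Finset.card_le_card hQT).trans hT.le), hcT'⟩
  choose T hTc hT using hcov
  refine (coveringNumber_le_card (T := G.biUnion T) ?_).trans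
    (Finset.card_biUnion_le.trans (Finset.sum_le_sum fun w _ => hTc w))
  intro x hx
  rw [limitSetOf_eq] at hx
  obtain ⟨γ, hγ⟩ := mem_iUnion.1 hx
  obtain ⟨n, hn, hmin⟩ := h.exists_stopWords hr γ
  cases n with
  | zero => exact absurd hn (by simpa [seqPrefix, h.ratio_nil] using hr1)
  | succ n =>
    have hw : seqPrefix γ n ∈ G := by
      refine hG _ ?_
      have := hmin n (by simp)
      rwa [take_seqPrefix γ n.le_succ] at this
    obtain ⟨p, hpF, hp⟩ := hF (γ n)
    have hp' : compMaps S (seqPrefix γ n) p ∈ compMaps S (seqPrefix γ (n + 1)) '' X := by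
      rw [seqPrefix_succ', compMaps_append]
      exact ⟨p, hFX hpF, by simp [compMaps, hp]⟩
    obtain ⟨z, hz, hpz⟩ := mem_iUnion₂.1 (hT (seqPrefix γ n) ⟨p, hpF, rfl⟩)
    refine mem_iUnion₂.2 ⟨z, Finset.mem_biUnion.2 ⟨_, hw, hz⟩, ?_⟩
    have h1 := h.dist_le_of_mem_image (mem_iInter.1 hγ n) hp'
    have h2 : A * diam X * ρ (seqPrefix γ (n + 1)) ≤ A * diam X * r :=
      mul_le_mul_of_nonneg_left hn hAD
    rw [mem_ball] at hpz ⊢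
    linarith [dist_triangle x (compMaps S (seqPrefix γ n) p) z]

lemma exists_rpow_mul_coveringNumber_le_of_fintype [Fintype I] (h : IsQuasiSimilarIFS X S ρ K A c)
    {t : ℝ} (ht : 0 ≤ t) (hsum : 1 ≤ ∑ i, (ρ [i] / K) ^ t)
    {F E : Set (EuclideanSpace ℝ (Fin d))} (hFX : F ⊆ X) (hE : Bornology.IsBounded E)
    (hFE : ∀ w, compMaps S w '' F ⊆ E) :
    ∃ C : ℝ, 0 < C ∧ ∀ r R : ℝ, 0 < r → r ≤ R → R ≤ 1 →
      (R / r) ^ t * coveringNumber F R ≤ C * coveringNumber E r := by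
  classical
  have hAD := h.diam_nonneg'
  have hA : 0 < A := by linarith [h.one_le_A]
  have hK : 0 < K := by linarith [h.one_le_K]
  have hFb : Bornology.IsBounded F := h.isCompact.isBounded.subset hFX
  obtain ⟨b, hb, hb1, hbρ⟩ := h.exists_pos_le_ratio
  obtain ⟨N, hN⟩ := h.exists_card_le (C := (A * diam X + 1) * (K / b)) (by positivity)
  obtain ⟨M, hM⟩ := exists_coveringNumber_le_mul (E := EuclideanSpace ℝ (Fin d))
    (show 0 < 2 * A * (K / b) by positivity)
  refine ⟨M * N + 1, by positivity, fun r R hr hrR hR => ?_⟩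
  have hR0 : 0 < R := hr.trans_le hrR
  have hδ : 0 < r / R := div_pos hr hR0
  have hδ1 : r / R ≤ 1 := (div_le_one hR0).2 hrR
  have hrδ : r ≤ r / R := by rw [le_div_iff₀ hR0]; nlinarith
  set Q := (h.finite_stopWords hδ).toFinset with hQ
  have hQs : ∀ w ∈ Q, w ∈ stopWords ρ (r / R) := fun w hw => (Set.Finite.mem_toFinset _).1 hw
  have hQρ : ∀ w ∈ Q, b / K * (r / R) ≤ ρ w := fun w hw =>
    h.le_ratio_of_mem_stopWords hb hb1 hbρ hδ hδ1 (hQs w hw)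
  obtain ⟨T, hT, hET⟩ := exists_card_eq_coveringNumber hE hr
  set P : List I → EuclideanSpace ℝ (Fin d) → Prop :=
    fun w z => (ball z r ∩ compMaps S w '' F).Nonempty with hP
  have hFw : ∀ w ∈ Q, coveringNumber F (2 * A * (K / b) * R) ≤ (T.filter (P w)).card := by
    intro w hw
    have htr : ∀ x ∈ F, ∀ y ∈ F, dist (compMaps S w x) (compMaps S w y) < 2 * r →
        dist (id x) (id y) < 2 * A * (K / b) * R := by
      intro x hx y hy hxy
      have h1 := h.le_dist w x (hFX hx) y (hFX hy)
      have h2 := mul_le_mul_of_nonneg_right (hQρ w hw) (dist_nonneg (x := x) (y := y))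
      have h3 : b / K * (r / R) * dist x y < A * (2 * r) :=
        (h2.trans h1).trans_lt (mul_lt_mul_of_pos_left hxy hA)
      calc dist x y = b / K * (r / R) * dist x y * (K / b * (R / r)) := by field_simp
        _ < A * (2 * r) * (K / b * (R / r)) := mul_lt_mul_of_pos_right h3 (by positivity)
        _ = 2 * A * (K / b) * R := by field_simp
    obtain ⟨U, hUT, hU, T', hT', hcT'⟩ := exists_cover_transport htr ((hFE w).trans hET)
    rw [image_id] at hcT'
    refine (coveringNumber_le_card hcT').trans (hT'.trans (Finset.card_le_card fun z hz => ?_))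
    exact Finset.mem_filter.2 ⟨hUT hz, hU z hz⟩
  have hmeet : ∀ z ∈ T, (Q.filter fun w => P w z).card ≤ N := by
    intro z _
    refine hN _ (b / K * (r / R)) z (by positivity) (fun w hw v hv => ?_) (fun w hw => ?_)
      fun w hw => ?_
    · exact stopWords_not_prefix (hQs w (Finset.mem_filter.1 hw).1)
        (hQs v (Finset.mem_filter.1 hv).1)
    · exact hQρ w (Finset.mem_filter.1 hw).1
    · obtain ⟨y, hyz, hyw⟩ := (Finset.mem_filter.1 hw).2
      intro x hx
      have h1 := h.dist_le_of_mem_image hx (image_mono hFX hyw)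
      have h2 : A * diam X * ρ w ≤ A * diam X * (r / R) :=
        mul_le_mul_of_nonneg_left (hQs w (Finset.mem_filter.1 hw).1).1 hAD
      rw [mem_ball] at hyz
      rw [mem_closedBall]
      calc dist x z ≤ dist x y + dist y z := dist_triangle _ _ _
        _ ≤ (A * diam X + 1) * (r / R) := by linarith
        _ = (A * diam X + 1) * (K / b) * (b / K * (r / R)) := by field_simp
  have hcount : Q.card * coveringNumber F (2 * A * (K / b) * R) ≤ T.card * N := by
    calc Q.card * coveringNumber F (2 * A * (K / b) * R)
        ≤ ∑ w ∈ Q, (T.filter (P w)).card := by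
          rw [← smul_eq_mul]
          exact Finset.card_nsmul_le_sum _ _ _ hFw
      _ = ∑ z ∈ T, (Q.filter fun w => P w z).card :=
          Finset.sum_card_bipartiteAbove_eq_sum_card_bipartiteBelow P
      _ ≤ T.card * N := by
          rw [← smul_eq_mul]
          exact Finset.sum_le_card_nsmul _ _ _ hmeet
  have hQc : (R / r) ^ t ≤ Q.card := by
    have h1 := h.one_le_card_stopWords_mul ht hsum hδ
    rw [← inv_div, Real.inv_rpow hδ.le, inv_le_iff_one_le_mul₀ (Real.rpow_pos_of_pos hδ t)]
    exact h1
  have hcount' : (Q.card : ℝ) * coveringNumber F (2 * A * (K / b) * R) ≤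
      coveringNumber E r * N := by
    rw [← hT]
    exact_mod_cast hcount
  have hM' : (coveringNumber F R : ℝ) ≤ M * coveringNumber F (2 * A * (K / b) * R) :=
    mod_cast hM F R hFb hR0
  calc (R / r) ^ t * coveringNumber F R
      ≤ Q.card * (M * coveringNumber F (2 * A * (K / b) * R)) :=
        mul_le_mul hQc hM' (by positivity) (by positivity)
    _ = M * (Q.card * coveringNumber F (2 * A * (K / b) * R)) := by ring
    _ ≤ M * (coveringNumber E r * N) := mul_le_mul_of_nonneg_left hcount' (by positivity)
    _ ≤ (M * N + 1) * coveringNumber E r := by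
        nlinarith [Nat.cast_nonneg (α := ℝ) (coveringNumber E r)]

/-- The part of the limit set coming from the fixed points forces many balls at small scales. -/
lemma exists_rpow_mul_coveringNumber_le [Countable I] [Nonempty I]
    (h : IsQuasiSimilarIFS X S ρ K A c) {t : ℝ} (ht : 0 ≤ t)
    (htd : t = 0 ∨ ENNReal.ofReal t < dimH (limitSetOf X S))
    {F : Set (EuclideanSpace ℝ (Fin d))} (hFX : F ⊆ X) (hF : ∀ p ∈ F, ∃ i, S i p = p) :
    ∃ C : ℝ, 0 < C ∧ ∀ r R : ℝ, 0 < r → r ≤ R → R ≤ 1 →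
      (R / r) ^ t * coveringNumber F R ≤ C * coveringNumber (limitSetOf X S) r := by
  obtain ⟨n, hn, W, hW, hsum⟩ : ∃ n ≥ 1, ∃ W : Finset (List I), (∀ w ∈ W, w.length = n) ∧
      1 ≤ ∑ w ∈ W, (ρ w / K) ^ t := by
    rcases ht.eq_or_lt with rfl | ht'
    · obtain ⟨i⟩ := ‹Nonempty I›
      exact ⟨1, le_rfl, {[i]}, by simp, by simp⟩
    · exact h.exists_one_le_sum ht' (htd.resolve_left ht'.ne')
  have h' := h.iterate hn (W := (W : Set (List I))) hW
  refine h'.exists_rpow_mul_coveringNumber_le_of_fintype ht ?_ hFX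
    (h.isCompact.isBounded.subset h.limitSetOf_subset) fun l => ?_
  · simp only [List.map_cons, List.map_nil, List.flatten_cons, List.flatten_nil, List.append_nil]
    rw [← Finset.sum_coe_sort] at hsum
    exact hsum
  · rw [compMaps_flatten]
    refine image_compMaps_subset_limitSetOf h.mapsTo hFX (fun p hp => ?_) _
    obtain ⟨i, hi⟩ := hF p hp
    exact ⟨i, [], p, hp, hi⟩

end IsQuasiSimilarIFS

lemma sFun_exp_neg_exp {α : Type*} [PseudoMetricSpace α] (E : Set α) (x : ℝ) :
    sFun E (Real.exp (-Real.exp x)) =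
      Real.log (coveringNumber E (Real.exp (-Real.exp x))) / Real.exp x := by
  rw [sFun, one_div, Real.log_inv, Real.log_exp, neg_neg]

lemma HasCoveringClass.exists_abs_log_le {α : Type*} [PseudoMetricSpace α] [ProperSpace α]
    {E : Set α} (hE : Bornology.IsBounded E) (hne : E.Nonempty) {f : ℝ → ℝ} {D : ℝ}
    (hf : ∀ x, f x ∈ Icc 0 D) (h : HasCoveringClass E f) {ε : ℝ} (hε : 0 < ε) :
    ∃ C, 0 ≤ C ∧ ∀ y, |Real.log (coveringNumber E (Real.exp (-Real.exp y))) - f y * Real.exp y| ≤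
      ε * Real.exp y + C := by
  have hlog : ∀ y, 0 ≤ Real.log (coveringNumber E (Real.exp (-Real.exp y))) := fun y =>
    Real.log_nonneg (mod_cast one_le_coveringNumber hE hne (Real.exp_pos _))
  obtain ⟨Y, hY⟩ := eventually_atTop.1 ((Metric.tendsto_nhds.1 h) ε hε)
  have hC : 0 ≤ Real.log (coveringNumber E (Real.exp (-Real.exp Y))) + D * Real.exp Y := by
    have := (hf 0).1.trans (hf 0).2
    have := hlog Y
    positivity
  refine ⟨_, hC, fun y => ?_⟩
  rcases le_total Y y with hy | hy
  · have h1 : dist (sFun E (Real.exp (-Real.exp y)) - f y) 0 < ε := hY y hy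
    rw [sFun_exp_neg_exp, Real.dist_eq, sub_zero] at h1
    have h2 : Real.log (coveringNumber E (Real.exp (-Real.exp y))) - f y * Real.exp y =
        (Real.log (coveringNumber E (Real.exp (-Real.exp y))) / Real.exp y - f y) *
          Real.exp y := by
      rw [sub_mul, div_mul_cancel₀ _ (Real.exp_ne_zero y)]
    rw [h2, abs_mul, Real.abs_exp]
    nlinarith [Real.exp_pos y]
  · have h1 : Real.log (coveringNumber E (Real.exp (-Real.exp y))) ≤
        Real.log (coveringNumber E (Real.exp (-Real.exp Y))) := by
      refine Real.log_le_log
        (mod_cast one_le_coveringNumber hE hne (Real.exp_pos _)) ?_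
      exact_mod_cast coveringNumber_anti hE (Real.exp_pos _)
        (Real.exp_le_exp.2 (neg_le_neg (Real.exp_le_exp.2 hy)))
    have h2 : f y * Real.exp y ≤ D * Real.exp Y :=
      mul_le_mul (hf y).2 (Real.exp_le_exp.2 hy) (Real.exp_pos y).le ((hf y).1.trans (hf y).2)
    have h3 : 0 ≤ f y * Real.exp y := mul_nonneg (hf y).1 (Real.exp_pos y).le
    have h4 := hlog y
    have h5 : 0 ≤ ε * Real.exp y := by positivity
    have h6 := hlog Y
    rw [abs_le]
    constructor <;> linarith

namespace IsQuasiSimilarIFS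

variable {d : ℕ} {I : Type} {X : Set (EuclideanSpace ℝ (Fin d))}
  {S : I → EuclideanSpace ℝ (Fin d) → EuclideanSpace ℝ (Fin d)} {ρ : List I → ℝ} {K A c : ℝ}

lemma dimH_limitSetOf_ne_top : dimH (limitSetOf X S) ≠ ⊤ := by
  refine ((dimH_mono (subset_univ _)).trans_lt ?_).ne
  rw [Real.dimH_univ_eq_finrank]
  exact ENNReal.natCast_lt_top _

lemma fixedPoint_mem_limitSetOf (h : IsQuasiSimilarIFS X S ρ K A c)
    {F : Set (EuclideanSpace ℝ (Fin d))} (hFX : F ⊆ X) (hF : ∀ p ∈ F, ∃ i, S i p = p) :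
    F ⊆ limitSetOf X S := by
  have := image_compMaps_subset_limitSetOf h.mapsTo hFX (fun p hp => by
    obtain ⟨i, hi⟩ := hF p hp
    exact ⟨i, [], p, hp, hi⟩) []
  simpa [compMaps] using this

lemma finite_ratio_gt {t C : ℝ} (ht : 0 ≤ t)
    (hC : ∀ G : Finset (List I), ∑ w ∈ G, ρ w ^ t ≤ C) {r : ℝ} (hr : 0 < r) :
    {w | r < ρ w}.Finite := by
  by_contra hinf
  obtain ⟨n, hn⟩ := exists_nat_gt (C / r ^ t)
  obtain ⟨G, hG, hGn⟩ := Set.Infinite.exists_subset_card_eq hinf n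
  have hrt : 0 < r ^ t := Real.rpow_pos_of_pos hr t
  rw [div_lt_iff₀ hrt] at hn
  refine absurd (hC G) (not_le.2 (hn.trans_le ?_))
  rw [← hGn, ← nsmul_eq_mul]
  exact Finset.card_nsmul_le_sum _ _ _ fun w hw =>
    Real.rpow_le_rpow hr.le (hG hw).le ht

lemma exists_log_coveringNumber_le (h : IsQuasiSimilarIFS X S ρ K A c) [Nonempty I]
    {F : Set (EuclideanSpace ℝ (Fin d))} (hFX : F ⊆ X) (hF : ∀ i, ∃ p ∈ F, S i p = p)
    {f g : ℝ → ℝ} {D : ℝ} (hf : ∀ x, f x ∈ Icc 0 D) (hcf : HasCoveringClass F f)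
    (hg : g ∈ GClass (dimH (limitSetOf X S)).toReal D) (hfg : ∀ x, f x ≤ g x) {ε : ℝ}
    (hε : 0 < ε) :
    ∃ C, ∀ x, Real.log (coveringNumber (limitSetOf X S) (Real.exp (-Real.exp x))) ≤
      (g x + ε) * Real.exp x + C := by
  set hd := (dimH (limitSetOf X S)).toReal with hhd
  have hd0 : 0 ≤ hd := ENNReal.toReal_nonneg
  have hmono := GClass.monotone_mul_exp hg
  have hne : F.Nonempty := by
    obtain ⟨i⟩ := ‹Nonempty I›
    obtain ⟨p, hp, -⟩ := hF i
    exact ⟨p, hp⟩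
  have hFb : Bornology.IsBounded F := h.isCompact.isBounded.subset hFX
  obtain ⟨C₀, hC₀, hC₀F⟩ := hcf.exists_abs_log_le hFb hne hf hε
  obtain ⟨C₁, hC₁⟩ := h.exists_sum_ratio_le (t := hd + ε / 2) (t' := hd + ε) (by positivity)
    ((ENNReal.lt_ofReal_iff_toReal_lt dimH_limitSetOf_ne_top).2 (by linarith)) (by linarith)
  obtain ⟨M, hM⟩ := h.coveringNumber_limitSetOf_le hFX hF
  have hC₁1 : 1 ≤ C₁ := by simpa [h.ratio_nil] using hC₁ {[]}
  refine ⟨C₀ + Real.log (M * C₁), fun x => ?_⟩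
  set L := Real.exp x with hL
  have hL0 : 0 < L := Real.exp_pos x
  have hfin := finite_ratio_gt (by positivity) hC₁ (Real.exp_pos (-L))
  set G := hfin.toFinset with hG
  have hGmem : ∀ w, w ∈ G ↔ Real.exp (-L) < ρ w := fun w => by simp [hG]
  have hterm : ∀ w ∈ G, (coveringNumber F (Real.exp (-L) / ρ w) : ℝ) ≤
      Real.exp (C₀ + (g x + ε) * L) * ρ w ^ (hd + ε) := by
    intro w hw
    have hρ := h.ratio_pos w
    set u := L + Real.log (ρ w) with hu
    have hu0 : 0 < u := by
      have := Real.log_lt_log (Real.exp_pos _) ((hGmem w).1 hw)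
      rw [Real.log_exp] at this
      linarith
    have huL : u ≤ L := by linarith [Real.log_nonpos hρ.le (h.ratio_le_one w)]
    have hR : Real.exp (-L) / ρ w = Real.exp (-Real.exp (Real.log u)) := by
      rw [Real.exp_log hu0, hu, neg_add, Real.exp_add, Real.exp_neg (Real.log _),
        Real.exp_log hρ, div_eq_mul_inv]
    have h1 := (abs_le.1 (hC₀F (Real.log u))).2
    have h2 := hmono ((Real.log_le_log hu0 huL).trans_eq (Real.log_exp x))
    simp only [Real.exp_log hu0] at h1 h2
    rw [Real.exp_log hu0] at hR
    have h3 : f (Real.log u) * u ≤ g (Real.log u) * u :=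
      mul_le_mul_of_nonneg_right (hfg _) hu0.le
    have hN : 1 ≤ coveringNumber F (Real.exp (-L) / ρ w) :=
      one_le_coveringNumber hFb hne (by positivity)
    rw [← Real.exp_log (show (0 : ℝ) < coveringNumber F (Real.exp (-L) / ρ w) by
      exact_mod_cast hN), Real.rpow_def_of_pos hρ, ← Real.exp_add, Real.exp_le_exp, hR]
    have h4 : (g x - hd) * Real.exp x = (g x - hd) * L := rfl
    have h5 : Real.log (ρ w) = u - L := by rw [hu]; ring
    rw [h5]
    nlinarith
  have h1 : (coveringNumber (limitSetOf X S) (Real.exp (-L)) : ℝ) ≤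
      M * (Real.exp (C₀ + (g x + ε) * L) * C₁) := by
    calc (coveringNumber (limitSetOf X S) (Real.exp (-L)) : ℝ)
        ≤ M * ∑ w ∈ G, (coveringNumber F (Real.exp (-L) / ρ w) : ℝ) := by
          exact_mod_cast hM _ G (Real.exp_pos _) (Real.exp_lt_one_iff.2 (by linarith))
            (fun w => (hGmem w).2) (fun w => (hGmem w).1)
      _ ≤ M * (Real.exp (C₀ + (g x + ε) * L) * C₁) := by
          refine mul_le_mul_of_nonneg_left ((Finset.sum_le_sum hterm).trans ?_) (by positivity)
          rw [← Finset.mul_sum]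
          exact mul_le_mul_of_nonneg_left (hC₁ G) (by positivity)
  have hN : (0 : ℝ) < coveringNumber (limitSetOf X S) (Real.exp (-L)) := by
    have hp : (limitSetOf X S).Nonempty := by
      obtain ⟨i⟩ := ‹Nonempty I›
      obtain ⟨p, hp, hip⟩ := hF i
      exact ⟨p, h.fixedPoint_mem_limitSetOf (F := {p}) (by simpa using hFX hp)
        (by simpa using ⟨i, hip⟩) rfl⟩
    exact_mod_cast one_le_coveringNumber (h.isCompact.isBounded.subset h.limitSetOf_subset) hp
      (Real.exp_pos _)
  have hMC : 0 < M * C₁ := by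
    have : (M : ℝ) ≠ 0 := by
      rintro hM0
      rw [hM0, zero_mul] at h1
      linarith
    have : 0 < (M : ℝ) := lt_of_le_of_ne (Nat.cast_nonneg M) this.symm
    positivity
  calc Real.log (coveringNumber (limitSetOf X S) (Real.exp (-L)))
      ≤ Real.log (M * C₁ * Real.exp (C₀ + (g x + ε) * L)) :=
        Real.log_le_log hN (h1.trans_eq (by ring))
    _ = (g x + ε) * L + (C₀ + Real.log (M * C₁)) := by
        rw [Real.log_mul hMC.ne' (Real.exp_ne_zero _), Real.log_exp]
        ring

lemma exists_le_log_coveringNumber [Countable I] [Nonempty I]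
    (h : IsQuasiSimilarIFS X S ρ K A c)
    {F : Set (EuclideanSpace ℝ (Fin d))} (hFX : F ⊆ X) (hne : F.Nonempty)
    (hF : ∀ p ∈ F, ∃ i, S i p = p)
    {f : ℝ → ℝ} {D : ℝ} (hf : ∀ x, f x ∈ Icc 0 D) (hcf : HasCoveringClass F f) {ε : ℝ}
    (hε : 0 < ε) :
    ∃ C, ∀ x, ∀ y ≤ x,
      ((dimH (limitSetOf X S)).toReal + (f y - (dimH (limitSetOf X S)).toReal) *
        Real.exp (y - x) - ε) * Real.exp x - C ≤
      Real.log (coveringNumber (limitSetOf X S) (Real.exp (-Real.exp x))) := by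
  set hd := (dimH (limitSetOf X S)).toReal with hhd
  have hFb : Bornology.IsBounded F := h.isCompact.isBounded.subset hFX
  obtain ⟨C₀, hC₀, hC₀F⟩ := hcf.exists_abs_log_le hFb hne hf hε
  set t := max (hd - ε) 0 with ht
  have htd : t = 0 ∨ ENNReal.ofReal t < dimH (limitSetOf X S) := by
    rcases le_total (hd - ε) 0 with h0 | h0
    · exact Or.inl (max_eq_right h0)
    · right
      rw [ht, max_eq_left h0, ENNReal.ofReal_lt_iff_lt_toReal h0 dimH_limitSetOf_ne_top]
      linarith
  obtain ⟨C₁, hC₁, hC₁N⟩ := h.exists_rpow_mul_coveringNumber_le (le_max_right _ _) htd hFX hF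
  refine ⟨C₀ + Real.log C₁, fun x y hyx => ?_⟩
  have hexp : Real.exp y ≤ Real.exp x := Real.exp_le_exp.2 hyx
  have h1 := hC₁N (Real.exp (-Real.exp x)) (Real.exp (-Real.exp y)) (Real.exp_pos _)
    (Real.exp_le_exp.2 (neg_le_neg hexp)) (Real.exp_le_one_iff.2 (by linarith [Real.exp_pos y]))
  have hNF : (1 : ℝ) ≤ coveringNumber F (Real.exp (-Real.exp y)) :=
    mod_cast one_le_coveringNumber hFb hne (Real.exp_pos _)
  have hNΛ : (1 : ℝ) ≤ coveringNumber (limitSetOf X S) (Real.exp (-Real.exp x)) :=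
    mod_cast one_le_coveringNumber (h.isCompact.isBounded.subset h.limitSetOf_subset)
      (hne.mono (h.fixedPoint_mem_limitSetOf hFX hF)) (Real.exp_pos _)
  have h2 := Real.log_le_log (by positivity) h1
  rw [Real.log_mul (by positivity) (by positivity), Real.log_mul (by positivity) (by positivity),
    ← Real.exp_sub, Real.log_rpow (Real.exp_pos _), Real.log_exp] at h2
  have h3 := (abs_le.1 (hC₀F y)).1
  have h4 : (hd - ε) * (Real.exp x - Real.exp y) ≤ t * (Real.exp x - Real.exp y) :=
    mul_le_mul_of_nonneg_right (le_max_left _ _) (by linarith)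
  have h5 : (hd + (f y - hd) * Real.exp (y - x) - ε) * Real.exp x =
      hd * Real.exp x + (f y - hd) * Real.exp y - ε * Real.exp x := by
    rw [Real.exp_sub]
    field_simp
  rw [h5]
  nlinarith

theorem hasCoveringClass_limitSetOf [Countable I] [Nonempty I]
    (h : IsQuasiSimilarIFS X S ρ K A c)
    {F : Set (EuclideanSpace ℝ (Fin d))} (hFX : F ⊆ X) (hF : ∀ p ∈ F, ∃ i, S i p = p)
    (hF' : ∀ i, ∃ p ∈ F, S i p = p) {f g : ℝ → ℝ} {D : ℝ}
    (hf : f ∈ GClass 0 D) (hcf : HasCoveringClass F f)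
    (hg : g ∈ GClass (dimH (limitSetOf X S)).toReal D) (hfg : ∀ x, f x ≤ g x)
    (hmin : ∀ g' ∈ GClass (dimH (limitSetOf X S)).toReal D,
      (∀ x, f x ≤ g' x) → ∀ x, g x ≤ g' x) :
    HasCoveringClass (limitSetOf X S) g := by
  have hne : F.Nonempty := by
    obtain ⟨i⟩ := ‹Nonempty I›
    obtain ⟨p, hp, -⟩ := hF' i
    exact ⟨p, hp⟩
  obtain ⟨G, hG, hfG, hGle⟩ := GClass.exists_envelope
    ((hg.2.1 0).1.trans (hg.2.1 0).2) hf
  have hgG := hmin G hG hfG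
  refine Metric.tendsto_nhds.2 fun ε hε => ?_
  obtain ⟨C, hC⟩ := h.exists_log_coveringNumber_le hFX hF' hf.2.1 hcf hg hfg (half_pos hε)
  obtain ⟨C', hC'⟩ := h.exists_le_log_coveringNumber hFX hne hF hf.2.1 hcf (half_pos hε)
  have hlarge := Real.tendsto_exp_atTop.eventually_gt_atTop (max C C' / (ε / 2))
  filter_upwards [hlarge] with x hx
  have hx0 := Real.exp_pos x
  rw [div_lt_iff₀ (half_pos hε)] at hx
  have hCx := (le_max_left C C').trans_lt hx
  have hCx' := (le_max_right C C').trans_lt hx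
  rw [sFun_exp_neg_exp, Real.dist_eq, sub_zero, abs_lt]
  constructor
  · rw [lt_sub_iff_add_lt, lt_div_iff₀ hx0]
    have h1 := (hgG x).trans (hGle x
      (Real.log (coveringNumber (limitSetOf X S) (Real.exp (-Real.exp x))) / Real.exp x +
        ε / 2 + C' / Real.exp x) fun y hy => ?_)
    · have h2 := mul_le_mul_of_nonneg_right h1 hx0.le
      rw [add_mul, add_mul, div_mul_cancel₀ _ hx0.ne', div_mul_cancel₀ _ hx0.ne'] at h2
      nlinarith
    · have h2 := hC' x y hy
      rw [add_right_comm, ← add_div, ← sub_le_iff_le_add, le_div_iff₀ hx0]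
      linarith
  · rw [sub_lt_iff_lt_add, div_lt_iff₀ hx0]
    have h1 := hC x
    nlinarith

end IsQuasiSimilarIFS

lemma IsConformalMap.norm_map {E F : Type*} [NormedAddCommGroup E] [NormedSpace ℝ E]
    [NormedAddCommGroup F] [NormedSpace ℝ F] [Nontrivial E] {f : E →L[ℝ] F}
    (h : IsConformalMap f) (v : E) : ‖f v‖ = ‖f‖ * ‖v‖ := by
  obtain ⟨c, -, li, rfl⟩ := h
  rw [norm_smul, LinearIsometry.norm_toContinuousLinearMap, mul_one,
    smul_apply, norm_smul, LinearIsometry.coe_toContinuousLinearMap,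
    li.norm_map]

lemma IsConformalMap.norm_pos {E F : Type*} [NormedAddCommGroup E] [NormedSpace ℝ E]
    [NormedAddCommGroup F] [NormedSpace ℝ F] [Nontrivial E] {f : E →L[ℝ] F}
    (h : IsConformalMap f) : 0 < ‖f‖ := by
  obtain ⟨v, hv⟩ := exists_ne (0 : E)
  refine norm_pos_iff.2 fun h0 => hv (h.injective ?_)
  simp [h0]

lemma IsConformalMap.norm_comp {E F G : Type*} [NormedAddCommGroup E] [NormedSpace ℝ E]
    [NormedAddCommGroup F] [NormedSpace ℝ F] [NormedAddCommGroup G] [NormedSpace ℝ G]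
    [Nontrivial E] [Nontrivial F] {g : F →L[ℝ] G} {f : E →L[ℝ] F}
    (hg : IsConformalMap g) (hf : IsConformalMap f) : ‖g.comp f‖ = ‖g‖ * ‖f‖ := by
  obtain ⟨v, hv⟩ := exists_ne (0 : E)
  have h := (hg.comp hf).norm_map v
  rw [ContinuousLinearMap.comp_apply, hg.norm_map, hf.norm_map, ← mul_assoc] at h
  exact (mul_right_cancel₀ (norm_ne_zero_iff.2 hv) h).symm

/-- A map whose derivative expands by more than `m` on a closed ball and which omits the value
`z` there, except possibly on the boundary, keeps distance at least `m * η` from `z` at the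
centre. -/
lemma mul_radius_le_norm_sub {E : Type*} [NormedAddCommGroup E] [NormedSpace ℝ E]
    [ProperSpace E] {f : E → E} {f' : E → E →L[ℝ] E} {x z : E} {η m : ℝ} (hη : 0 ≤ η) (hm : 0 ≤ m)
    (hf : ∀ p ∈ closedBall x η, HasFDerivAt f (f' p) p)
    (hz : ∀ p ∈ ball x η, f p ≠ z)
    (hsurj : ∀ p ∈ ball x η, ∀ u, u ≠ 0 → ∃ v, f' p v = u ∧ m * ‖v‖ < ‖u‖) :
    m * η ≤ ‖f x - z‖ := by
  by_contra! hlt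
  have hcont : ContinuousOn (fun p => ‖f p - z‖ + m * ‖p - x‖) (closedBall x η) := by
    have : ContinuousOn f (closedBall x η) := fun p hp => (hf p hp).continuousAt.continuousWithinAt
    fun_prop
  obtain ⟨p, hp, hmin⟩ := (isCompact_closedBall x η).exists_isMinOn ⟨x, mem_closedBall_self hη⟩ hcont
  have hpx := hmin (mem_closedBall_self hη)
  simp only [mem_ofPred_eq, sub_self, norm_zero, mul_zero, add_zero] at hpx
  have hpb : p ∈ ball x η := by
    rw [mem_ball_iff_norm]
    by_contra! hge
    have := mul_le_mul_of_nonneg_left hge hm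
    linarith [norm_nonneg (f p - z)]
  have hu : f p - z ≠ 0 := sub_ne_zero.2 (hz p hpb)
  obtain ⟨v, hv, hvn⟩ := hsurj p hpb (-(f p - z)) (neg_ne_zero.2 hu)
  rw [norm_neg] at hvn
  set u := f p - z with hu_def
  set δ := (‖u‖ - m * ‖v‖) / 2 with hδ
  have hδ0 : 0 < δ := by rw [hδ]; linarith
  have hder : HasDerivAt (fun t : ℝ => f (p + t • v)) (-u) 0 := by
    have h1 : HasDerivAt (fun t : ℝ => p + t • v) v 0 := by
      simpa using ((hasDerivAt_id (0 : ℝ)).smul_const v).const_add p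
    have h2 : HasFDerivAt f (f' p) (p + (0 : ℝ) • v) := by simpa using hf p hp
    have := h2.comp_hasDerivAt 0 h1
    rwa [hv] at this
  have hev := (hasDerivAt_iff_isLittleO.1 hder).def hδ0
  have hball : ∀ᶠ t : ℝ in 𝓝 0, p + t • v ∈ ball x η := by
    have : ContinuousAt (fun t : ℝ => p + t • v) 0 := by fun_prop
    exact this.eventually_mem (by simpa using isOpen_ball.mem_nhds hpb)
  have hone : ∀ᶠ t : ℝ in 𝓝 0, t < 1 := eventually_lt_nhds one_pos
  obtain ⟨t, ht, ht1, ht2, ht3⟩ := ((eventually_mem_nhdsWithin (a := (0 : ℝ)) (s := Ioi 0)).and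
    ((hev.and (hball.and hone)).filter_mono nhdsWithin_le_nhds)).exists
  have ht0 : (0 : ℝ) < t := ht
  have hmt := hmin (ball_subset_closedBall ht2)
  simp only [mem_ofPred_eq, zero_smul, add_zero, sub_zero, Real.norm_eq_abs,
    abs_of_pos ht0] at hmt ht1
  have e1 : ‖f (p + t • v) - z‖ ≤ δ * t + (1 - t) * ‖u‖ := by
    have : f (p + t • v) - z = (f (p + t • v) - f p - t • -u) + (1 - t) • u := by
      rw [hu_def]; module
    rw [this]
    refine (norm_add_le _ _).trans (add_le_add ht1 ?_)
    rw [norm_smul, Real.norm_eq_abs, abs_of_pos (by linarith)]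
  have e2 : ‖p + t • v - x‖ ≤ ‖p - x‖ + t * ‖v‖ := by
    have : p + t • v - x = (p - x) + t • v := by abel
    rw [this]
    refine (norm_add_le _ _).trans (add_le_add le_rfl ?_)
    rw [norm_smul, Real.norm_eq_abs, abs_of_pos ht0]
  have e3 := mul_le_mul_of_nonneg_left e2 hm
  have : 0 < t * δ := mul_pos ht0 hδ0
  have h4 : t * (2 * δ) = t * (‖u‖ - m * ‖v‖) := by rw [hδ]; ring
  nlinarith

namespace CIFS

variable {d : ℕ} (Φ : CIFS d)

lemma mapsTo_extension (w : List Φ.I) : MapsTo (compMaps Φ.T w) Φ.V Φ.V :=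
  compMaps_mapsTo Φ.hTmaps w

lemma extension_eq (w : List Φ.I) {x} (hx : x ∈ Φ.X) :
    compMaps Φ.T w x = compMaps Φ.S w x := by
  induction w with
  | nil => rfl
  | cons i w ih =>
    simp only [compMaps, Function.comp_apply, ih]
    exact Φ.hTagree i _ (compMaps_mapsTo Φ.hSmaps w hx)

lemma injOn_extension (w : List Φ.I) : InjOn (compMaps Φ.T w) Φ.V := by
  induction w with
  | nil => exact injOn_id _
  | cons i w ih => exact (Φ.hTinj i).comp ih (Φ.mapsTo_extension w)

lemma differentiableAt_extension (w : List Φ.I) {x} (hx : x ∈ Φ.V) :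
    DifferentiableAt ℝ (compMaps Φ.T w) x := by
  induction w with
  | nil => exact differentiableAt_id
  | cons i w ih =>
    have hV := Φ.hVopen.mem_nhds (Φ.mapsTo_extension w hx)
    exact (((Φ.hTdiff i).contDiffAt hV).differentiableAt one_ne_zero).comp x ih

lemma fderiv_extension_append (w v : List Φ.I) {x} (hx : x ∈ Φ.V) :
    fderiv ℝ (compMaps Φ.T (w ++ v)) x =
      (fderiv ℝ (compMaps Φ.T w) (compMaps Φ.T v x)).comp (fderiv ℝ (compMaps Φ.T v) x) := by
  rw [compMaps_append]
  exact fderiv_comp x (Φ.differentiableAt_extension w (Φ.mapsTo_extension v hx))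
    (Φ.differentiableAt_extension v hx)

lemma isConformalMap_fderiv (w : List Φ.I) {x} (hx : x ∈ Φ.V) :
    IsConformalMap (fderiv ℝ (compMaps Φ.T w) x) := by
  induction w with
  | nil =>
    simp only [compMaps, fderiv_id]
    exact isConformalMap_id
  | cons i w ih =>
    rw [← List.singleton_append, Φ.fderiv_extension_append _ _ hx]
    exact (Φ.hTconf i _ (Φ.mapsTo_extension w hx)).comp ih

lemma dist_compMaps_le (w : List Φ.I) {x y} (hx : x ∈ Φ.X) (hy : y ∈ Φ.X) :
    dist (compMaps Φ.S w x) (compMaps Φ.S w y) ≤ Φ.c ^ w.length * dist x y := by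
  induction w with
  | nil => simp [compMaps]
  | cons i w ih =>
    refine (Φ.hcontr i _ (compMaps_mapsTo Φ.hSmaps w hx) _
      (compMaps_mapsTo Φ.hSmaps w hy)).2.trans ?_
    rw [List.length_cons, pow_succ', mul_assoc]
    exact mul_le_mul_of_nonneg_left ih Φ.hc0.le

/-- The size of the derivative of `S_w` at a reference point. -/
def ratioAt (x₀ : EuclideanSpace ℝ (Fin d)) (w : List Φ.I) : ℝ :=
  ‖fderiv ℝ (compMaps Φ.T w) x₀‖

variable {Φ} {x₀ : EuclideanSpace ℝ (Fin d)}

lemma dist_extension_le_of_mem_ball (hx₀ : x₀ ∈ Φ.V) {z x y : EuclideanSpace ℝ (Fin d)} {r : ℝ}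
    (hzr : ball z r ⊆ Φ.V) (hx : x ∈ ball z r) (hy : y ∈ ball z r) (w : List Φ.I) :
    dist (compMaps Φ.T w x) (compMaps Φ.T w y) ≤ Φ.K * Φ.ratioAt x₀ w * dist x y := by
  rw [dist_eq_norm, dist_eq_norm]
  exact (convex_ball z r).norm_image_sub_le_of_norm_fderiv_le
    (fun p hp => Φ.differentiableAt_extension w (hzr hp))
    (fun p hp => Φ.hBD w p (hzr hp) x₀ hx₀) hy hx

lemma ratioAt_nonneg (w : List Φ.I) : 0 ≤ Φ.ratioAt x₀ w := norm_nonneg _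

lemma exists_dist_extension_le (hx₀ : x₀ ∈ Φ.V) {x y} (hx : x ∈ Φ.V) (hy : y ∈ Φ.V) :
    ∃ N : ℝ, ∀ w, dist (compMaps Φ.T w x) (compMaps Φ.T w y) ≤ N * Φ.ratioAt x₀ w := by
  refine Φ.hVconn.isPreconnected.induction₂ (fun x y => ∃ N : ℝ, ∀ w,
    dist (compMaps Φ.T w x) (compMaps Φ.T w y) ≤ N * Φ.ratioAt x₀ w) ?_ ?_ ?_ hx hy
  · intro z hz
    obtain ⟨r, hr, hzr⟩ := Metric.isOpen_iff.1 Φ.hVopen z hz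
    filter_upwards [mem_nhdsWithin_of_mem_nhds (ball_mem_nhds z hr)] with p hp
    refine ⟨Φ.K * dist z p, fun w => ?_⟩
    rw [mul_right_comm]
    exact dist_extension_le_of_mem_ball hx₀ hzr (mem_ball_self hr) hp w
  · rintro a b c - - - ⟨N, hN⟩ ⟨M, hM⟩
    refine ⟨N + M, fun w => ?_⟩
    rw [add_mul]
    exact (dist_triangle _ _ _).trans (add_le_add (hN w) (hM w))
  · rintro a b - - ⟨N, hN⟩
    exact ⟨N, fun w => by rw [dist_comm]; exact hN w⟩

lemma exists_forall_dist_extension_le (hx₀ : x₀ ∈ Φ.V) :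
    ∃ N : ℝ, 0 ≤ N ∧ ∀ x ∈ Φ.X, ∀ w,
      dist (compMaps Φ.T w x) (compMaps Φ.T w x₀) ≤ N * Φ.ratioAt x₀ w := by
  refine Φ.hXcompact.induction_on (p := fun s => ∃ N : ℝ, 0 ≤ N ∧ ∀ x ∈ s, ∀ w,
      dist (compMaps Φ.T w x) (compMaps Φ.T w x₀) ≤ N * Φ.ratioAt x₀ w) ⟨0, le_rfl, by simp⟩ ?_ ?_ ?_
  · rintro s t hst ⟨N, hN0, hN⟩
    exact ⟨N, hN0, fun x hx => hN x (hst hx)⟩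
  · rintro s t ⟨N, hN0, hN⟩ ⟨M, hM0, hM⟩
    refine ⟨N + M, add_nonneg hN0 hM0, ?_⟩
    rintro x (hx | hx) w
    · exact (hN x hx w).trans
        (mul_le_mul_of_nonneg_right (le_add_of_nonneg_right hM0) (ratioAt_nonneg w))
    · exact (hM x hx w).trans
        (mul_le_mul_of_nonneg_right (le_add_of_nonneg_left hN0) (ratioAt_nonneg w))
  · intro z hz
    obtain ⟨r, hr, hzr⟩ := Metric.isOpen_iff.1 Φ.hVopen z (Φ.hXV hz)
    obtain ⟨N, hN⟩ := exists_dist_extension_le hx₀ (Φ.hXV hz) hx₀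
    refine ⟨ball z r, mem_nhdsWithin_of_mem_nhds (ball_mem_nhds z hr), Φ.K * r + |N|,
      add_nonneg (mul_nonneg (zero_le_one.trans Φ.hK) hr.le) (abs_nonneg N), fun x hx w => ?_⟩
    rw [add_mul]
    refine (dist_triangle _ (compMaps Φ.T w z) _).trans (add_le_add ?_ ((hN w).trans
      (mul_le_mul_of_nonneg_right (le_abs_self N) (ratioAt_nonneg w))))
    refine (dist_extension_le_of_mem_ball hx₀ hzr hx (mem_ball_self hr) w).trans ?_
    rw [mul_right_comm]
    exact mul_le_mul_of_nonneg_right (mul_le_mul_of_nonneg_left (mem_ball.1 hx).le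
      (zero_le_one.trans Φ.hK)) (ratioAt_nonneg w)

variable (Φ) in
lemma exists_closedBall_subset : ∃ δ > 0, ∀ x ∈ Φ.X, closedBall x δ ⊆ Φ.V := by
  obtain ⟨δ, hδ, h⟩ := Φ.hXcompact.exists_cthickening_subset_open Φ.hVopen Φ.hXV
  exact ⟨δ, hδ, fun x hx => (closedBall_subset_cthickening hx δ).trans h⟩

lemma exists_dist_le (hx₀ : x₀ ∈ Φ.V) : ∃ A : ℝ, ∀ w, ∀ x ∈ Φ.X, ∀ y ∈ Φ.X,
    dist (compMaps Φ.S w x) (compMaps Φ.S w y) ≤ A * Φ.ratioAt x₀ w * dist x y := by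
  obtain ⟨δ, hδ, hball⟩ := Φ.exists_closedBall_subset
  obtain ⟨N, hN0, hN⟩ := exists_forall_dist_extension_le hx₀
  have hK0 : 0 ≤ Φ.K := zero_le_one.trans Φ.hK
  refine ⟨Φ.K + 2 * N / δ, fun w x hx y hy => ?_⟩
  rw [← Φ.extension_eq w hx, ← Φ.extension_eq w hy, add_mul, add_mul]
  have hρ := ratioAt_nonneg (Φ := Φ) (x₀ := x₀) w
  rcases lt_or_ge (dist x y) δ with hlt | hge
  · refine (dist_extension_le_of_mem_ball hx₀ (ball_subset_closedBall.trans (hball x hx))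
      (mem_ball_self hδ) (mem_ball'.2 hlt) w).trans (le_add_of_nonneg_right ?_)
    positivity
  · have h1 := (dist_triangle_right (compMaps Φ.T w x) (compMaps Φ.T w y)
      (compMaps Φ.T w x₀)).trans (add_le_add (hN x hx w) (hN y hy w))
    have h2 : 2 * N * Φ.ratioAt x₀ w ≤ 2 * N / δ * Φ.ratioAt x₀ w * dist x y := by
      have : 2 * N * Φ.ratioAt x₀ w = 2 * N / δ * Φ.ratioAt x₀ w * δ := by field_simp
      rw [this]
      exact mul_le_mul_of_nonneg_left hge (by positivity)
    have h3 : 0 ≤ Φ.K * Φ.ratioAt x₀ w * dist x y := by positivity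
    linarith

lemma ratioAt_le (hx₀ : x₀ ∈ interior Φ.X) (w : List Φ.I) :
    Φ.ratioAt x₀ w ≤ Φ.c ^ w.length := by
  have hX := interior_subset hx₀
  refine (Φ.differentiableAt_extension w (Φ.hXV hX)).hasFDerivAt.le_of_lip'
    (pow_nonneg Φ.hc0.le _) ?_
  filter_upwards [mem_interior_iff_mem_nhds.1 hx₀] with x hx
  rw [Φ.extension_eq w hx, Φ.extension_eq w hX, ← dist_eq_norm, ← dist_eq_norm]
  exact Φ.dist_compMaps_le w hx hX

variable (Φ) in
lemma exists_fixedPoint (i : Φ.I) : ∃ p ∈ Φ.fixedPoints, Φ.S i p = p := by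
  have hcontr : ContractingWith ⟨Φ.c, Φ.hc0.le⟩ ((Φ.hSmaps i).restrict (Φ.S i) Φ.X Φ.X) :=
    ⟨NNReal.coe_lt_coe.1 Φ.hc1,
      LipschitzWith.of_dist_le_mul fun x y => (Φ.hcontr i x x.2 y y.2).2⟩
  obtain ⟨x₀, hx₀⟩ := Φ.hXint
  obtain ⟨p, hp, hfix, -⟩ := hcontr.exists_fixedPoint' Φ.hXcompact.isComplete (Φ.hSmaps i)
    (interior_subset hx₀) (edist_ne_top _ _)
  exact ⟨p, ⟨hp, i, hfix⟩, hfix⟩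

variable [Nontrivial (EuclideanSpace ℝ (Fin d))]

lemma ratioAt_pos (hx₀ : x₀ ∈ Φ.V) (w : List Φ.I) : 0 < Φ.ratioAt x₀ w :=
  (Φ.isConformalMap_fderiv w hx₀).norm_pos

lemma exists_le_dist (hx₀ : x₀ ∈ Φ.V) : ∃ A : ℝ, ∀ w, ∀ x ∈ Φ.X, ∀ y ∈ Φ.X,
    Φ.ratioAt x₀ w * dist x y ≤ A * dist (compMaps Φ.S w x) (compMaps Φ.S w y) := by
  obtain ⟨δ, hδ, hball⟩ := Φ.exists_closedBall_subset
  have hK : 0 < Φ.K := one_pos.trans_le Φ.hK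
  set D := diam Φ.X with hD
  have hD0 : 0 ≤ D := diam_nonneg
  refine ⟨2 * Φ.K * (1 + D / δ), fun w x hx y hy => ?_⟩
  rw [← Φ.extension_eq w hx, ← Φ.extension_eq w hy]
  have hρ := ratioAt_pos hx₀ w
  have hxy : dist x y ≤ D := dist_le_diam_of_mem Φ.hXcompact.isBounded hx hy
  have hη : 0 ≤ min δ (dist x y) := le_min hδ.le dist_nonneg
  have hsub : closedBall x (min δ (dist x y)) ⊆ Φ.V :=
    (closedBall_subset_closedBall (min_le_left _ _)).trans (hball x hx)
  have hm : 0 < Φ.ratioAt x₀ w / (2 * Φ.K) := by positivity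
  have key : Φ.ratioAt x₀ w / (2 * Φ.K) * min δ (dist x y) ≤
      ‖compMaps Φ.T w x - compMaps Φ.T w y‖ := by
    refine mul_radius_le_norm_sub hη hm.le
      (fun p hp => (Φ.differentiableAt_extension w (hsub hp)).hasFDerivAt) (fun p hp hpy => ?_) ?_
    · have := Φ.injOn_extension w (hsub (ball_subset_closedBall hp)) (Φ.hXV hy) hpy
      rw [this, mem_ball'] at hp
      exact (hp.trans_le (min_le_right _ _)).false
    · intro p hp u hu
      have hpV := hsub (ball_subset_closedBall hp)
      have hconf := Φ.isConformalMap_fderiv w hpV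
      have hsurj : Function.Surjective (fderiv ℝ (compMaps Φ.T w) p) :=
        LinearMap.surjective_of_injective (f := (fderiv ℝ (compMaps Φ.T w) p).toLinearMap)
          hconf.injective
      obtain ⟨v, rfl⟩ := hsurj u
      have hv : 0 < ‖v‖ := norm_pos_iff.2 (by rintro rfl; exact hu (map_zero _))
      refine ⟨v, rfl, ?_⟩
      rw [hconf.norm_map]
      refine mul_lt_mul_of_pos_right ?_ hv
      have h1 : Φ.ratioAt x₀ w ≤ Φ.K * ‖fderiv ℝ (compMaps Φ.T w) p‖ := Φ.hBD w x₀ hx₀ p hpV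
      rw [div_lt_iff₀ (by positivity)]
      nlinarith
  rw [dist_eq_norm (compMaps Φ.T w x)]
  have hmin : dist x y ≤ (1 + D / δ) * min δ (dist x y) := by
    rcases le_total δ (dist x y) with h | h
    · rw [min_eq_left h, add_mul, div_mul_cancel₀ _ hδ.ne']
      linarith
    · rw [min_eq_right h, add_mul, one_mul]
      exact le_add_of_nonneg_right (by positivity)
  calc Φ.ratioAt x₀ w * dist x y
      ≤ Φ.ratioAt x₀ w * ((1 + D / δ) * min δ (dist x y)) := by gcongr
    _ = 2 * Φ.K * (1 + D / δ) * (Φ.ratioAt x₀ w / (2 * Φ.K) * min δ (dist x y)) := by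
        field_simp
    _ ≤ _ := by gcongr

lemma ratioAt_append (hx₀ : x₀ ∈ Φ.V) (w v : List Φ.I) :
    Φ.ratioAt x₀ w * Φ.ratioAt x₀ v ≤ Φ.K * Φ.ratioAt x₀ (w ++ v) := by
  have hv := Φ.mapsTo_extension v hx₀
  unfold ratioAt
  rw [Φ.fderiv_extension_append w v hx₀, (Φ.isConformalMap_fderiv w hv).norm_comp
    (Φ.isConformalMap_fderiv v hx₀), ← mul_assoc]
  exact mul_le_mul_of_nonneg_right (Φ.hBD w x₀ hx₀ _ hv) (norm_nonneg _)

variable (Φ) in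
lemma exists_isQuasiSimilarIFS : ∃ (ρ : List Φ.I → ℝ) (A : ℝ),
    IsQuasiSimilarIFS Φ.X Φ.S ρ Φ.K A Φ.c := by
  obtain ⟨x₀, hx₀⟩ := Φ.hXint
  have hV := Φ.hXV (interior_subset hx₀)
  obtain ⟨A, hA⟩ := exists_dist_le hV
  obtain ⟨B, hB⟩ := exists_le_dist hV
  have hAM : A ≤ max 1 (max A B) := (le_max_left _ _).trans (le_max_right _ _)
  have hBM : B ≤ max 1 (max A B) := (le_max_right _ _).trans (le_max_right _ _)
  exact ⟨Φ.ratioAt x₀, max 1 (max A B),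
    { isCompact := Φ.hXcompact
      nonempty_interior := Φ.hXint
      mapsTo := Φ.hSmaps
      image_interior := Φ.hOSCin
      disjoint := Φ.hOSCdisj
      one_le_K := Φ.hK
      one_le_A := le_max_left _ _
      c_pos := Φ.hc0
      c_lt_one := Φ.hc1
      ratio_nil := by
        simp only [ratioAt, compMaps, fderiv_id]
        exact ContinuousLinearMap.norm_id
      ratio_pos := ratioAt_pos hV
      ratio_le := ratioAt_le hx₀
      ratio_append := ratioAt_append hV
      dist_le := fun w x hx y hy => (hA w x hx y hy).trans (mul_le_mul_of_nonneg_right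
        (mul_le_mul_of_nonneg_right hAM (ratioAt_nonneg w)) dist_nonneg)
      le_dist := fun w x hx y hy => (hB w x hx y hy).trans
        (mul_le_mul_of_nonneg_right hBM dist_nonneg) }⟩

end CIFS

/-- If `F` has covering class `f` and `g` is the pointwise minimal element
of `𝒢(dim_H Λ, d)` bounded below by `f`, then `Λ` has covering class `g`. -/
theorem limitSet_covering_class {d : ℕ} (hd : 1 ≤ d) (Phi : CIFS d) (f g : ℝ → ℝ)
    (hf : f ∈ GClass 0 d) (hcf : HasCoveringClass Phi.fixedPoints f)
    (hg : g ∈ GClass (dimH Phi.limitSet).toReal d) (hfg : ∀ x, f x ≤ g x)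
    (hmin : ∀ g' ∈ GClass (dimH Phi.limitSet).toReal d,
      (∀ x, f x ≤ g' x) → ∀ x, g x ≤ g' x) :
    HasCoveringClass Phi.limitSet g := by
  have := Phi.hIcount
  have := Phi.hInonempty
  have : Nonempty (Fin d) := ⟨⟨0, hd⟩⟩
  obtain ⟨ρ, A, h⟩ := Phi.exists_isQuasiSimilarIFS
  exact h.hasCoveringClass_limitSetOf (fun p hp => hp.1) (fun p hp => hp.2)
    Phi.exists_fixedPoint hf hcf hg hfg hmin

end
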